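/- arXiv:1508.07760 — 10 statements merged into one kernel-verified Lean document; each statement's English description precedes it below -/
import Mathlib

section
/- There are only finitely many triples of integers (u, v, w) with 1 ≤ u < v < w such that 1 + uv, 1 + uw and 1 + vw are all Tribonacci numbers; that is, the set of triples (u,v,w) with 1 ≤ u < v < w for which there exist positive integers x, y, z with 1 + uv = T_x, 1 + uw = T_y and 1 + vw = T_z is finite. -/
/-- The Tribonacci sequence: `T 0 = T 1 = 0`, `T 2 = 1`,
`T (n+3) = T (n+2) + T (n+1) + T n`. -/
def T : ℕ → ℕ
  | 0 => 0
  | 1 => 0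
  | 2 => 1
  | (n + 3) => T (n + 2) + T (n + 1) + T n

namespace Trib

theorem exists_root : ∃ a : ℝ, 1.8 < a ∧ a < 1.9 ∧ a ^ 3 = a ^ 2 + a + 1 := by
  have hc : ContinuousOn (fun a : ℝ => a ^ 3 - a ^ 2 - a - 1) (Set.Icc 1.8 1.9) := by fun_prop
  have := intermediate_value_Ioo (by norm_num : (1.8 : ℝ) ≤ 1.9) hc
  have h0 : (0 : ℝ) ∈ Set.Ioo ((1.8 : ℝ) ^ 3 - 1.8 ^ 2 - 1.8 - 1)
      ((1.9 : ℝ) ^ 3 - 1.9 ^ 2 - 1.9 - 1) := by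
    constructor <;> norm_num
  obtain ⟨a, ha, h⟩ := this h0
  exact ⟨a, ha.1, ha.2, by simp only at h; linarith⟩

noncomputable def α : ℝ := Classical.choose exists_root

theorem α_lb : 1.8 < α := (Classical.choose_spec exists_root).1
theorem α_ub : α < 1.9 := (Classical.choose_spec exists_root).2.1
theorem α_eq : α ^ 3 = α ^ 2 + α + 1 := (Classical.choose_spec exists_root).2.2
theorem α_pos : 0 < α := by linarith [α_lb]
theorem α_one : 1 < α := by linarith [α_lb]
theorem α_ne : α ≠ 0 := α_pos.ne'
theorem α_inv : α⁻¹ = α ^ 2 - α - 1 := by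
  have := α_ne
  field_simp
  linear_combination -α_eq

noncomputable def D : ℝ := 3 * α ^ 2 - 2 * α - 1
theorem D_pos : 1 < D := by unfold D; nlinarith [α_lb]
noncomputable def κ : ℝ := D⁻¹
theorem κ_pos : 0 < κ := inv_pos.2 (by linarith [D_pos])
theorem κ_lt : κ < 1 := inv_lt_one_of_one_lt₀ D_pos
theorem κD : κ * D = 1 := inv_mul_cancel₀ (by linarith [D_pos])
theorem Dκ : κ⁻¹ = D := inv_inv _

theorem norm_mod3 : ∀ p q r : ZMod 3,
    p * ((p + r) * (p + q + 2 * r) - (q + r) * (q + 2 * r))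
      - q * (r * (p + q + 2 * r) - (q + r) * (q + r))
      + r * (r * (q + 2 * r) - (p + r) * (q + r)) = 0 → p = 0 ∧ q = 0 ∧ r = 0 := by
  decide

theorem norm_zero (p q r : ℤ) (h : (p : ℝ) + q * α + r * α ^ 2 = 0) :
    p * ((p + r) * (p + q + 2 * r) - (q + r) * (q + 2 * r))
      - q * (r * (p + q + 2 * r) - (q + r) * (q + r))
      + r * (r * (q + 2 * r) - (p + r) * (q + r)) = 0 := by
  have h2 : (r : ℝ) + (p + r) * α + (q + r) * α ^ 2 = 0 := by
    linear_combination α * h - r * α_eq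
  have h3 : (q + r : ℝ) + (q + 2 * r) * α + (p + q + 2 * r) * α ^ 2 = 0 := by
    linear_combination α * h2 - (q + r) * α_eq
  have : ((p * ((p + r) * (p + q + 2 * r) - (q + r) * (q + 2 * r))
      - q * (r * (p + q + 2 * r) - (q + r) * (q + r))
      + r * (r * (q + 2 * r) - (p + r) * (q + r)) : ℤ) : ℝ) = 0 := by
    push_cast
    linear_combination ((p + r) * (p + q + 2 * r) - (q + r) * (q + 2 * r) : ℝ) * h
      - (q * (p + q + 2 * r) - r * (q + 2 * r) : ℝ) * h2
      + (q * (q + r) - r * (p + r) : ℝ) * h3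
  exact_mod_cast this

theorem dvd3 (k : ℕ) : ∀ (p q r : ℤ), (p : ℝ) + q * α + r * α ^ 2 = 0 →
    (3 : ℤ) ^ k ∣ p ∧ (3 : ℤ) ^ k ∣ q ∧ (3 : ℤ) ^ k ∣ r := by
  induction k with
  | zero => simp
  | succ k ih =>
    intro p q r h
    have h1 := norm_zero p q r h
    have h2 := congrArg (Int.cast : ℤ → ZMod 3) h1
    push_cast at h2
    obtain ⟨hp, hq, hr⟩ := norm_mod3 _ _ _ h2
    obtain ⟨p', rfl⟩ := (ZMod.intCast_zmod_eq_zero_iff_dvd p 3).1 hp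
    obtain ⟨q', rfl⟩ := (ZMod.intCast_zmod_eq_zero_iff_dvd q 3).1 hq
    obtain ⟨r', rfl⟩ := (ZMod.intCast_zmod_eq_zero_iff_dvd r 3).1 hr
    push_cast at h
    obtain ⟨a, b, c⟩ := ih p' q' r' (by linarith)
    simp only [pow_succ']
    exact ⟨mul_dvd_mul_left _ a, mul_dvd_mul_left _ b, mul_dvd_mul_left _ c⟩

theorem zero_of_dvd3 (p : ℤ) (h : ∀ k : ℕ, (3 : ℤ) ^ k ∣ p) : p = 0 := by
  apply Int.eq_zero_of_abs_lt_dvd (h p.natAbs)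
  rw [Int.abs_eq_natAbs]
  exact_mod_cast Nat.lt_pow_self (by norm_num)

theorem lin_indep (p q r : ℤ) (h : (p : ℝ) + q * α + r * α ^ 2 = 0) : p = 0 ∧ q = 0 ∧ r = 0 :=
  ⟨zero_of_dvd3 p fun k => (dvd3 k p q r h).1, zero_of_dvd3 q fun k => (dvd3 k p q r h).2.1,
    zero_of_dvd3 r fun k => (dvd3 k p q r h).2.2⟩

theorem T_rec (n : ℕ) : T (n + 3) = T (n + 2) + T (n + 1) + T n := by
  rfl

theorem pow_form (n : ℕ) :
    α ^ (n + 1) = (T (n + 1) : ℝ) * α ^ 2 + ((T (n + 2) : ℝ) - T (n + 1)) * α + T n := by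
  induction n with
  | zero => simp [T]
  | succ n ih =>
    rw [pow_succ, ih]
    have := T_rec n
    rw [this]
    push_cast
    linear_combination (T (n + 1) : ℝ) * α_eq

theorem zpow_form (e : ℤ) : ∃ p q r : ℤ, α ^ e = (p : ℝ) + q * α + r * α ^ 2 := by
  induction e using Int.induction_on with
  | zero => exact ⟨1, 0, 0, by simp⟩
  | succ n ih =>
    obtain ⟨p, q, r, h⟩ := ih
    refine ⟨r, p + r, q + r, ?_⟩
    rw [zpow_add_one₀ α_ne, h]; push_cast
    linear_combination (r : ℝ) * α_eq
  | pred n ih =>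
    obtain ⟨p, q, r, h⟩ := ih
    refine ⟨q - p, r - p, p, ?_⟩
    rw [zpow_sub_one₀ α_ne, h, α_inv]; push_cast
    linear_combination ((q : ℝ) + r * α) * α_eq

noncomputable def g (n : ℕ) : ℝ := T n - κ * α ^ n

theorem T_eq (n : ℕ) : (T n : ℝ) = κ * α ^ n + g n := by unfold g; ring

theorem g_rec3 (n : ℕ) : g (n + 3) = g (n + 2) + g (n + 1) + g n := by
  unfold g; rw [T_rec]; push_cast
  linear_combination -κ * α ^ n * α_eq

theorem g_rec (n : ℕ) : g (n + 2) = (1 - α) * g (n + 1) - (α ^ 2 - α - 1) * g n := by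
  induction n with
  | zero =>
    have := κD
    unfold D at this
    simp [g, T]
    linear_combination -this
  | succ n ih =>
    rw [g_rec3, ih]
    linear_combination -g n * α_eq 

theorem g_inv (n : ℕ) : α ^ n * (g (n + 1) ^ 2 - (1 - α) * g n * g (n + 1)
    + (α ^ 2 - α - 1) * g n ^ 2) = κ := by
  induction n with
  | zero =>
    have := κD
    unfold D at this
    simp [g, T]
    linear_combination κ * this
  | succ n ih =>
    rw [g_rec]
    have hb : α * (α ^ 2 - α - 1) = 1 := by linear_combination α_eq
    linear_combination ih + α ^ n * (g (n + 1) ^ 2 - (1 - α) * g n * g (n + 1)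
      + (α ^ 2 - α - 1) * g n ^ 2) * hb

theorem g_bound (n : ℕ) : α ^ n * g n ^ 2 ≤ 4 := by
  have h := g_inv n
  have hb : 0.5 < α⁻¹ := by
    rw [lt_inv_comm₀ (by norm_num) α_pos]; linarith [α_ub]
  rw [α_inv] at hb
  have h1 : g n ^ 2 / 4 ≤ (g (n + 1) ^ 2 - (1 - α) * g n * g (n + 1)
    + (α ^ 2 - α - 1) * g n ^ 2) := by
    have h3 : (1 - α) ^ 2 ≤ 0.81 := by nlinarith [α_lb, α_ub]
    nlinarith [sq_nonneg (g (n + 1) - (1 - α) / 2 * g n), sq_nonneg (g n),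
      mul_le_mul_of_nonneg_right h3 (sq_nonneg (g n)), mul_le_mul_of_nonneg_right hb.le (sq_nonneg (g n))]
  have h2 := mul_le_mul_of_nonneg_left h1 (pow_pos α_pos n).le
  linarith [κ_lt]

def R : ℕ → ℤ
  | 0 => 4
  | 1 => -2
  | 2 => 12
  | n + 3 => - R (n + 2) - R (n + 1) + R n

theorem R_mod (n : ℕ) : (R n : ZMod 11) = 4 * 5 ^ n ∧ (R (n + 1) : ZMod 11) = 4 * 5 ^ (n + 1) ∧
    (R (n + 2) : ZMod 11) = 4 * 5 ^ (n + 2) := by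
  induction n with
  | zero => simp [R]; decide
  | succ n ih =>
    obtain ⟨h0, h1, h2⟩ := ih
    refine ⟨h1, h2, ?_⟩
    have : R (n + 1 + 2) = - R (n + 2) - R (n + 1) + R n := by rw [show n + 1 + 2 = n + 3 by ring, R]
    rw [this]; push_cast; rw [h0, h1, h2]
    have h11 : (11 : ZMod 11) = 0 := by decide
    linear_combination (-4 * 14 * 5 ^ n) * h11

theorem R_not (n : ℕ) : ¬ (11 : ℤ) ∣ R n := by
  intro h
  have h1 := (ZMod.intCast_zmod_eq_zero_iff_dvd (R n) 11).2 (by exact_mod_cast h)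
  rw [(R_mod n).1] at h1
  have h5 : (5 : ZMod 11) ≠ 0 := by decide
  have h4 : (4 : ZMod 11) ≠ 0 := by decide
  have : Fact (Nat.Prime 11) := ⟨by norm_num⟩
  exact mul_ne_zero h4 (pow_ne_zero n h5) h1

noncomputable def Q (n : ℕ) : ℝ := 44 * κ * α ^ n * g n + (α ^ 2 - α - 1) ^ n * D

theorem Q_rec (n : ℕ) : Q (n + 3) = - Q (n + 2) - Q (n + 1) + Q n := by
  have hb : (α ^ 2 - α - 1) ^ 3 + (α ^ 2 - α - 1) ^ 2 + (α ^ 2 - α - 1) - 1 = 0 := by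
    rw [← α_inv]; have := α_ne; field_simp; linear_combination -α_eq
  have hg : α ^ 3 * g (n + 3) + α ^ 2 * g (n + 2) + α * g (n + 1) - g n = 0 := by
    rw [g_rec (n + 1), g_rec n]
    linear_combination ((1 - α - α ^ 2 + α ^ 3) * g n - α * g (n + 1)) * α_eq
  unfold Q
  linear_combination 44 * κ * α ^ n * hg + (α ^ 2 - α - 1) ^ n * D * hb

theorem R_eq_Q (n : ℕ) : (R n : ℝ) = Q n ∧ (R (n + 1) : ℝ) = Q (n + 1) ∧
    (R (n + 2) : ℝ) = Q (n + 2) := by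
  induction n with
  | zero =>
    have h := κD
    have hk : D ≠ 0 := by linarith [D_pos]
    have e (r t m : ℝ) (b : ℝ) (h1 : r * D ^ 2 = 44 * m * (t * D - m) + b * D ^ 3) :
        r = 44 * κ * m * (t - κ * m) + b * D := by
      apply mul_right_cancel₀ (pow_ne_zero 2 hk)
      rw [h1]
      linear_combination (-44 * m * t * D + 44 * m ^ 2 * (κ * D + 1)) * h
    refine ⟨?_, ?_, ?_⟩
    · simp only [R, Q, g, T]
      apply e; unfold D; push_cast
      linear_combination ((-49) * α ^ 0 + (27) * α ^ 1 + (27) * α ^ 2 + (-27) * α ^ 3) * α_eq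
    · simp only [R, Q, g, T]
      apply e; unfold D; push_cast
      linear_combination ((3) * α ^ 0 + (12) * α ^ 1 + (-55) * α ^ 2 + (-9) * α ^ 3
        + (54) * α ^ 4 + (-27) * α ^ 5) * α_eq
    · simp only [R, Q, g, T]
      apply e; unfold D; push_cast
      linear_combination ((-13) * α ^ 0 + (-43) * α ^ 1 + (22) * α ^ 2 + (94) * α ^ 3
        + (-100) * α ^ 4 + (-36) * α ^ 5 + (81) * α ^ 6 + (-27) * α ^ 7) * α_eq
  | succ n ih =>
    obtain ⟨h0, h1, h2⟩ := ih
    refine ⟨h1, h2, ?_⟩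
    have : R (n + 1 + 2) = - R (n + 2) - R (n + 1) + R n := by rw [show n + 1 + 2 = n + 3 by ring, R]
    rw [this, show n + 1 + 2 = n + 3 by ring, Q_rec]; push_cast; rw [h0, h1, h2]

theorem R_eq (n : ℕ) : (R n : ℝ) = 44 * κ * α ^ n * g n + (α⁻¹) ^ n * D := by
  rw [α_inv]; exact (R_eq_Q n).1

open Filter Topology

section filt
variable {S : Type*} (𝓕 : Ultrafilter S)

theorem const_of_bdd (f : S → ℤ) (A B : ℤ) (h : ∀ᶠ s in (𝓕 : Filter S), A ≤ f s ∧ f s ≤ B) :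
    ∃ d, ∀ᶠ s in (𝓕 : Filter S), f s = d := by
  have h1 : (⋃ d ∈ Set.Icc A B, {s | f s = d}) ∈ 𝓕 := by
    filter_upwards [h] with s hs
    simpa using hs
  rw [Ultrafilter.finite_biUnion_mem_iff (Set.finite_Icc A B)] at h1
  obtain ⟨d, _, hd⟩ := h1
  exact ⟨d, hd⟩

theorem dich_lb (f : S → ℤ) (A : ℤ) (h : ∀ᶠ s in (𝓕 : Filter S), A ≤ f s) :
    (∃ d, ∀ᶠ s in (𝓕 : Filter S), f s = d) ∨ Tendsto f 𝓕 atTop := by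
  by_cases hc : ∃ d, ∀ᶠ s in (𝓕 : Filter S), f s = d
  · exact Or.inl hc
  · right
    rw [tendsto_atTop]
    intro B
    by_contra hB
    rw [← Ultrafilter.eventually_not] at hB
    apply hc
    apply const_of_bdd 𝓕 f A B
    filter_upwards [h, hB] with s h1 h2
    exact ⟨h1, by lia⟩

theorem trich (f : S → ℤ) :
    (∃ d, ∀ᶠ s in (𝓕 : Filter S), f s = d) ∨ Tendsto f 𝓕 atTop ∨ Tendsto f 𝓕 atBot := by
  by_cases h : ∀ᶠ s in (𝓕 : Filter S), 0 ≤ f s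
  · rcases dich_lb 𝓕 f 0 h with h | h
    · exact Or.inl h
    · exact Or.inr (Or.inl h)
  · rw [← Ultrafilter.eventually_not] at h
    rcases dich_lb 𝓕 (fun s => - f s) 0 (by filter_upwards [h] with s hs; lia) with ⟨d, h⟩ | h
    · left
      exact ⟨-d, by filter_upwards [h] with s hs; lia⟩
    · right; right
      exact tendsto_neg_atTop_iff.1 h

theorem int_conv (f : S → ℤ) (L : ℝ) (h : Tendsto (fun s => (f s : ℝ)) 𝓕 (𝓝 L)) :
    ∃ m : ℤ, (m : ℝ) = L ∧ ∀ᶠ s in (𝓕 : Filter S), f s = m := by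
  obtain ⟨d, hd⟩ := const_of_bdd 𝓕 f (⌊L⌋ - 1) (⌈L⌉ + 1) (by
    have h1 := h.eventually (Ioo_mem_nhds (by linarith : L - 1 < L) (by linarith : L < L + 1))
    filter_upwards [h1] with s hs
    have h2 := Int.floor_le L
    have h3 := Int.le_ceil L
    constructor
    · have : ((⌊L⌋ - 1 : ℤ) : ℝ) ≤ f s := by push_cast; linarith [hs.1]
      exact_mod_cast this
    · have : (f s : ℝ) ≤ ((⌈L⌉ + 1 : ℤ) : ℝ) := by push_cast; linarith [hs.2]
      exact_mod_cast this)
  refine ⟨d, ?_, hd⟩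
  have h2 : Tendsto (fun s => (f s : ℝ)) 𝓕 (𝓝 (d : ℝ)) :=
    tendsto_const_nhds.congr' (by filter_upwards [hd] with s hs; rw [hs])
  exact tendsto_nhds_unique h2 h

variable {l : Filter S}

theorem zpow_top (f : S → ℤ) (h : Tendsto f l atTop) : Tendsto (fun s => α ^ f s) l atTop := by
  have h1 := (tendsto_rpow_atTop_of_base_gt_one α α_one).comp
    ((tendsto_intCast_atTop_atTop (R := ℝ)).comp h)
  refine h1.congr fun s => ?_
  simp [Real.rpow_intCast]

theorem zpow_bot (f : S → ℤ) (h : Tendsto f l atBot) : Tendsto (fun s => α ^ f s) l (𝓝 0) := by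
  have h1 := (zpow_top (fun s => - f s) (tendsto_neg_atTop_iff.2 h)).inv_tendsto_atTop
  refine h1.congr fun s => ?_
  simp

theorem mul_g (f : S → ℤ) (x : S → ℕ) (h : Tendsto (fun s => 2 * f s - x s) l atBot) :
    Tendsto (fun s => α ^ f s * g (x s)) l (𝓝 0) := by
  have h1 : Tendsto (fun s => (α ^ f s * g (x s)) ^ 2) l (𝓝 0) := by
    have h2 : Tendsto (fun s => 4 * α ^ (2 * f s - x s)) l (𝓝 0) := by
      simpa using (zpow_bot _ h).const_mul 4
    refine squeeze_zero (fun s => sq_nonneg _) (fun s => ?_) h2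
    have h3 := g_bound (x s)
    have h4 : (α ^ f s) ^ 2 = α ^ (2 * f s - x s) * α ^ (x s) := by
      rw [← zpow_natCast α (x s), ← zpow_add₀ α_ne, ← zpow_natCast, ← zpow_mul]
      congr 1; push_cast; ring
    rw [mul_pow, h4]
    have h5 : 0 < α ^ (2 * f s - x s) := zpow_pos α_pos _
    nlinarith [mul_le_mul_of_nonneg_left h3 h5.le]
  have h2 := h1.sqrt
  simp only [Real.sqrt_sq_eq_abs, Real.sqrt_zero] at h2
  exact (tendsto_zero_iff_abs_tendsto_zero _).2 h2

theorem g_tend (x : S → ℕ) (h : Tendsto x l atTop) : Tendsto (fun s => g (x s)) l (𝓝 0) := by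
  have h1 := mul_g (l := l) (fun _ => 0) x (by
    have : Tendsto (fun s => (x s : ℤ)) l atTop := tendsto_natCast_atTop_atTop.comp h
    simpa using this)
  simpa using h1

theorem approx (f : S → ℤ) : ∃ N : S → ℤ, ∃ p q r : ℤ,
    Tendsto (fun s => κ * α ^ f s - N s) 𝓕 (𝓝 (κ * (p + q * α + r * α ^ 2))) := by
  rcases trich 𝓕 f with ⟨d, hd⟩ | h | h
  · obtain ⟨p, q, r, e⟩ := zpow_form d
    refine ⟨fun _ => 0, p, q, r, ?_⟩
    rw [← e]
    refine tendsto_const_nhds.congr' ?_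
    filter_upwards [hd] with s hs
    simp [hs]
  · refine ⟨fun s => T (f s).toNat, 0, 0, 0, ?_⟩
    have h1 : Tendsto (fun s => (f s).toNat) 𝓕 atTop := by
      rw [tendsto_atTop] at h ⊢
      intro b
      filter_upwards [h b] with s hs
      lia
    have h2 := (g_tend _ h1).neg
    simp only [Int.cast_zero, zero_mul, add_zero, mul_zero]
    rw [neg_zero] at h2
    refine h2.congr' ?_
    filter_upwards [h.eventually_ge_atTop 0] with s hs
    have h3 : α ^ f s = α ^ (f s).toNat := by
      rw [← zpow_natCast, Int.toNat_of_nonneg hs]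
    rw [h3, Int.cast_natCast, T_eq]; ring
  · refine ⟨fun _ => 0, 0, 0, 0, ?_⟩
    simpa using (zpow_bot _ h).const_mul κ

theorem inv_lt : α⁻¹ < 0.6 := by
  rw [inv_lt_comm₀ α_pos (by norm_num)]; have := α_lb; norm_num at *; linarith

theorem lim_neg (f : S → ℤ) (h : ∀ᶠ s in (𝓕 : Filter S), 1 ≤ f s) :
    ∃ t : ℝ, 0 ≤ t ∧ t < 0.6 ∧ Tendsto (fun s => α ^ (- f s)) 𝓕 (𝓝 t) ∧
      (t = 0 → Tendsto f 𝓕 atTop) := by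
  rcases dich_lb 𝓕 f 1 h with ⟨d, hd⟩ | h1
  · have hd1 : 1 ≤ d := by
      obtain ⟨s, h1, h2⟩ := (h.and hd).exists
      lia
    have hp : 0 < α ^ (-d) := zpow_pos α_pos _
    refine ⟨α ^ (-d), hp.le, ?_, ?_, fun h0 => absurd h0 hp.ne'⟩
    · refine lt_of_le_of_lt ?_ inv_lt
      rw [← zpow_neg_one]
      exact zpow_le_zpow_right₀ α_one.le (by lia)
    · refine tendsto_const_nhds.congr' ?_
      filter_upwards [hd] with s hs
      rw [hs]
  · exact ⟨0, le_rfl, by norm_num, zpow_bot _ (tendsto_neg_atBot_iff.2 h1), fun _ => h1⟩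

end filt

theorem T_mono : Monotone T := by
  apply monotone_nat_of_le_succ
  intro n
  match n with
  | 0 => simp [T]
  | 1 => simp [T]
  | n + 2 => rw [show n + 2 + 1 = n + 3 by ring, T_rec]; lia

theorem T_pos (n : ℕ) : 1 ≤ T (n + 2) := T_mono (show 2 ≤ n + 2 by lia)

theorem rho_tend {S : Type*} {l : Filter S} (x : S → ℕ) (h : Tendsto x l atTop) :
    Tendsto (fun s => ((T (x s) : ℝ) - 1) / (κ * α ^ (x s))) l (𝓝 1) := by
  have hz : Tendsto (fun s => (x s : ℤ)) l atTop := tendsto_natCast_atTop_atTop.comp h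
  have h1 := zpow_bot (fun s => -(x s : ℤ)) (tendsto_neg_atBot_iff.2 hz)
  have h2 := ((g_tend x h).const_sub 1).mul (h1.const_mul D)
  have h3 := h2.const_sub 1
  simp only [mul_zero, sub_zero] at h3
  refine h3.congr fun s => ?_
  have hk := κ_pos.ne'
  have hp : α ^ (x s) ≠ 0 := pow_ne_zero _ α_ne
  rw [T_eq, zpow_neg, zpow_natCast, ← Dκ]
  field_simp
  ring

theorem case_const {S : Type*} (𝓕 : Ultrafilter S) (u v : S → ℤ) (x y z : S → ℕ)
    (hu : ∀ s, 1 ≤ u s) (huv : ∀ s, u s < v s) (hx : ∀ s, 1 + u s * v s = T (x s))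
    (hyz : ∀ s, y s < z s)
    (hF : ∀ s, v s * ((T (y s) : ℤ) - 1) = u s * ((T (z s) : ℤ) - 1))
    (hy : Tendsto y 𝓕 atTop) (hz : Tendsto z 𝓕 atTop) (d : ℤ)
    (hd : ∀ᶠ s in (𝓕 : Filter S), (x s : ℤ) = d) : False := by
  have hb : ∀ᶠ s in (𝓕 : Filter S), u s ≤ T d.toNat ∧ v s ≤ T d.toNat := by
    filter_upwards [hd] with s hs
    have : x s = d.toNat := by lia
    have h1 := hx s
    rw [this] at h1
    have := hu s
    have := huv s
    constructor <;> nlinarith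
  obtain ⟨u0, hu0⟩ := const_of_bdd 𝓕 u 1 (T d.toNat) (by
    filter_upwards [hb] with s hs; exact ⟨hu s, hs.1⟩)
  obtain ⟨v0, hv0⟩ := const_of_bdd 𝓕 v 1 (T d.toNat) (by
    filter_upwards [hb] with s hs; exact ⟨by linarith [hu s, huv s], hs.2⟩)
  have hu1 : 1 ≤ u0 := by
    obtain ⟨s, hs⟩ := hu0.exists
    rw [← hs]; exact hu s
  have ry := rho_tend y hy
  have rz := rho_tend z hz
  have key : ∀ᶠ s in (𝓕 : Filter S), α ^ (-((z s : ℤ) - y s)) *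
      (v0 * (((T (y s) : ℝ) - 1) / (κ * α ^ (y s)))) =
        u0 * (((T (z s) : ℝ) - 1) / (κ * α ^ (z s))) := by
    filter_upwards [hu0, hv0] with s h1 h2
    have h3 : (v s : ℝ) * ((T (y s) : ℝ) - 1) = u s * ((T (z s) : ℝ) - 1) := by
      exact_mod_cast hF s
    rw [h1, h2] at h3
    rw [neg_sub, zpow_sub₀ α_ne, zpow_natCast, zpow_natCast]
    have hk := κ_pos.ne'
    have hp : α ^ (y s) ≠ 0 := pow_ne_zero _ α_ne
    have hp : α ^ (z s) ≠ 0 := pow_ne_zero _ α_ne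
    field_simp
    linarith
  obtain ⟨t, -, -, ht, ht0⟩ := lim_neg 𝓕 (fun s => (z s : ℤ) - y s)
    (Eventually.of_forall fun s => by have := hyz s; lia)
  have l1 := ht.mul (ry.const_mul (v0 : ℝ))
  have l2 := (rz.const_mul (u0 : ℝ)).congr' (by filter_upwards [key] with s hs; exact hs.symm)
  have heq := tendsto_nhds_unique l1 l2
  rw [mul_one, mul_one] at heq
  have hu1' : (1 : ℝ) ≤ u0 := by exact_mod_cast hu1
  rcases dich_lb 𝓕 (fun s => (z s : ℤ) - y s) 1
    (Eventually.of_forall fun s => by have := hyz s; lia) with ⟨e, he⟩ | h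
  · have he1 : 1 ≤ e := by
      obtain ⟨s, hs⟩ := he.exists
      have := hyz s
      lia
    have l3 : Tendsto (fun s => α ^ (-((z s : ℤ) - y s))) 𝓕 (𝓝 (α ^ (-e))) := by
      refine tendsto_const_nhds.congr' ?_
      filter_upwards [he] with s hs
      rw [hs]
    have := tendsto_nhds_unique ht l3
    rw [this] at heq
    obtain ⟨n, hn⟩ : ∃ n : ℕ, e = (n + 1 : ℕ) := ⟨(e - 1).toNat, by lia⟩
    rw [hn, zpow_neg, zpow_natCast] at heq
    have hp : α ^ (n + 1) ≠ 0 := pow_ne_zero _ α_ne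
    have h4 : (v0 : ℝ) = u0 * α ^ (n + 1) := by
      field_simp at heq; linarith
    rw [pow_form] at h4
    have h5 := lin_indep (u0 * T n - v0) (u0 * (T (n + 2) - T (n + 1))) (u0 * T (n + 1)) (by
      push_cast; linarith)
    obtain ⟨-, h6, h7⟩ := h5
    have hne : u0 ≠ 0 := by lia
    have h8 := (mul_eq_zero.1 h6).resolve_left hne
    have h9 := (mul_eq_zero.1 h7).resolve_left hne
    have := T_pos n
    lia
  · have l3 := zpow_bot _ (tendsto_neg_atBot_iff.2 h)
    have := tendsto_nhds_unique ht l3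
    rw [this] at heq
    linarith

theorem case_inf {S : Type*} (𝓕 : Ultrafilter S) (u : S → ℤ) (x y z : S → ℕ)
    (hu : ∀ s, 1 ≤ u s) (hxy : ∀ s, x s < y s) (hyz : ∀ s, y s < z s)
    (hF : ∀ s, u s ^ 2 * ((T (z s) : ℤ) - 1) = ((T (x s) : ℤ) - 1) * ((T (y s) : ℤ) - 1))
    (hx : Tendsto x 𝓕 atTop) (hy : Tendsto y 𝓕 atTop) (hz : Tendsto z 𝓕 atTop) : False := by
  have gx := g_tend x hx
  have gy := g_tend y hy
  have gz := g_tend z hz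
  have hxZ : Tendsto (fun s => (x s : ℤ)) 𝓕 atTop := tendsto_natCast_atTop_atTop.comp hx
  have hyZ : Tendsto (fun s => (y s : ℤ)) 𝓕 atTop := tendsto_natCast_atTop_atTop.comp hy
  have hzZ : Tendsto (fun s => (z s : ℤ)) 𝓕 atTop := tendsto_natCast_atTop_atTop.comp hz
  obtain ⟨δ, hδ⟩ : ∃ δ : S → ℤ, ∀ s, δ s = z s - y s := ⟨_, fun s => rfl⟩
  obtain ⟨ε, hε⟩ : ∃ ε : S → ℤ, ∀ s, ε s = y s - x s := ⟨_, fun s => rfl⟩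
  obtain ⟨U, hU⟩ : ∃ U : S → ℤ, ∀ s, U s = x s + y s - z s := ⟨_, fun s => rfl⟩
  obtain ⟨ρ, hρ⟩ : ∃ ρ : S → ℝ, ∀ s, ρ s = ((T (z s) : ℝ) - 1) / (κ * α ^ (z s)) :=
    ⟨_, fun s => rfl⟩
  obtain ⟨h, hh⟩ : ∃ h : S → ℝ, ∀ s, h s = (u s : ℝ) ^ 2 - κ * α ^ U s := ⟨_, fun s => rfl⟩
  have hδ1 : ∀ s, 1 ≤ δ s := fun s => by have := hyz s; have := hδ s; lia
  have hε1 : ∀ s, 1 ≤ ε s := fun s => by have := hxy s; have := hε s; lia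
  have rz : Tendsto ρ 𝓕 (𝓝 1) := (rho_tend z hz).congr fun s => (hρ s).symm
  have hk := κ_pos.ne'
  have exact1 : ∀ s, α ^ δ s * h s * ρ s = -(1 - g (x s)) - α ^ (-ε s) * (1 - g (y s))
      + α ^ (-δ s) * α ^ (-ε s) * (1 - g (z s))
      + α ^ (-(y s : ℤ)) * ((1 - g (x s)) * (1 - g (y s)) * D) := by
    intro s
    have h3 : (u s : ℝ) ^ 2 * ((T (z s) : ℝ) - 1) = ((T (x s) : ℝ) - 1) * ((T (y s) : ℝ) - 1) := by
      exact_mod_cast hF s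
    rw [T_eq, T_eq, T_eq] at h3
    rw [hρ, hh, hU, hδ, hε, T_eq, ← Dκ]
    simp only [neg_sub]
    rw [zpow_sub₀ α_ne, zpow_sub₀ α_ne, zpow_sub₀ α_ne, zpow_sub₀ α_ne, zpow_add₀ α_ne, zpow_neg]
    simp only [zpow_natCast]
    have hp1 : α ^ (x s) ≠ 0 := pow_ne_zero _ α_ne
    have hp2 : α ^ (y s) ≠ 0 := pow_ne_zero _ α_ne
    have hp3 : α ^ (z s) ≠ 0 := pow_ne_zero _ α_ne
    generalize α ^ (x s) = X at *
    generalize α ^ (y s) = Y at *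
    generalize α ^ (z s) = Z at *
    field_simp
    linear_combination Z * h3
  obtain ⟨t, t0, t1, ht, htt⟩ := lim_neg 𝓕 δ (Eventually.of_forall hδ1)
  obtain ⟨e, e0, e1, he, hee⟩ := lim_neg 𝓕 ε (Eventually.of_forall hε1)
  have ly := zpow_bot (fun s => -(y s : ℤ)) (tendsto_neg_atBot_iff.2 hyZ)
  have ox := gx.const_sub 1
  have oy := gy.const_sub 1
  have oz := gz.const_sub 1
  simp only [sub_zero] at ox oy oz
  have L1 : Tendsto (fun s => α ^ δ s * h s) 𝓕 (𝓝 (-(1 + e - t * e))) := by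
    have h1 := (((ox.neg.sub (he.mul oy)).add ((ht.mul he).mul oz)).add
      (ly.mul ((ox.mul oy).mul_const D))).div rz one_ne_zero
    have h2 : (-1 - e * 1 + t * e * 1 + 0 * (1 * 1 * D)) / 1 = -(1 + e - t * e) := by ring
    rw [h2] at h1
    refine h1.congr' ?_
    filter_upwards [rz.eventually_ne one_ne_zero] with s hs
    simp only [Pi.div_apply]
    rw [← exact1]
    field_simp
  have hte : 1 ≤ 1 + e - t * e := by nlinarith
  have L2 : Tendsto h 𝓕 (𝓝 (-(t * (1 + e - t * e)))) := by
    have h1 := ht.mul L1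
    rw [mul_neg] at h1
    refine h1.congr fun s => ?_
    rw [zpow_neg]
    have : α ^ δ s ≠ 0 := zpow_ne_zero _ α_ne
    field_simp
  have hneg : ∀ᶠ s in (𝓕 : Filter S), h s < 0 := by
    filter_upwards [L1.eventually_lt_const (show -(1 + e - t * e) < 0 by linarith)] with s hs
    have : 0 < α ^ δ s := zpow_pos α_pos _
    by_contra hc
    push Not at hc
    have := mul_nonneg this.le hc
    linarith
  have hU1 : ∀ᶠ s in (𝓕 : Filter S), 1 ≤ U s := by
    filter_upwards [hneg] with s hs
    rw [hh] at hs
    by_contra hc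
    have h1 : α ^ U s ≤ 1 := zpow_le_one_of_nonpos₀ α_one.le (by lia)
    have h2 : (1 : ℝ) ≤ u s := by exact_mod_cast hu s
    nlinarith [κ_pos, κ_lt]
  rcases dich_lb 𝓕 U 1 hU1 with ⟨m, hm⟩ | hUt
  · -- U constant
    have hm1 : 1 ≤ m := by
      obtain ⟨s, h1, h2⟩ := (hU1.and hm).exists
      lia
    have hδt : Tendsto δ 𝓕 atTop := by
      refine (tendsto_atTop_add_const_right _ (-m) hxZ).congr' ?_
      filter_upwards [hm] with s hs
      rw [hδ, ← hs, hU]; ring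
    have : t = 0 := tendsto_nhds_unique ht (zpow_bot _ (tendsto_neg_atBot_iff.2 hδt))
    rw [this, zero_mul, neg_zero] at L2
    obtain ⟨M, hM, hMe⟩ := int_conv 𝓕 (fun s => u s ^ 2) (κ * α ^ m) (by
      have h1 := L2.add_const (κ * α ^ m)
      rw [zero_add] at h1
      refine h1.congr' ?_
      filter_upwards [hm] with s hs
      rw [hh, hs]; push_cast; ring)
    obtain ⟨s, hs⟩ := hMe.exists
    have hM1 : 0 < M := by rw [← hs]; have := hu s; positivity
    obtain ⟨n, hn⟩ : ∃ n : ℕ, m = (n + 1 : ℕ) := ⟨(m - 1).toNat, by lia⟩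
    rw [hn, zpow_natCast, pow_form] at hM
    have h4 : M * D = (T (n + 1) : ℝ) * α ^ 2 + ((T (n + 2) : ℝ) - T (n + 1)) * α + T n := by
      rw [hM]
      linear_combination ((T (n + 1) : ℝ) * α ^ 2 + ((T (n + 2) : ℝ) - T (n + 1)) * α + T n) * κD
    unfold D at h4
    have h5 := lin_indep (T n + M) (T (n + 2) - T (n + 1) + 2 * M) (T (n + 1) - 3 * M) (by
      push_cast; linarith)
    lia
  · have hUn : Tendsto (fun s => (U s).toNat) 𝓕 atTop := by
      rw [tendsto_atTop] at hUt ⊢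
      intro b
      filter_upwards [hUt b] with s hs
      lia
    have gU := g_tend _ hUn
    have hUp : ∀ᶠ s in (𝓕 : Filter S), α ^ U s = α ^ (U s).toNat := by
      filter_upwards [hU1] with s hs
      rw [← zpow_natCast, Int.toNat_of_nonneg (by lia)]
    obtain ⟨M, hM, hMe⟩ := int_conv 𝓕 (fun s => u s ^ 2 - T (U s).toNat)
      (-(t * (1 + e - t * e))) (by
        have h1 := L2.sub gU
        rw [sub_zero] at h1
        refine h1.congr' ?_
        filter_upwards [hUp] with s hs
        rw [hh, hs]; push_cast; rw [T_eq]; ring)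
    have hM0 : M = 0 := by
      have h1 : (M : ℝ) < 1 := by rw [hM]; nlinarith
      have h2 : (-1 : ℝ) < M := by rw [hM]; nlinarith [mul_nonneg t0 e0]
      have h1' : M < 1 := by exact_mod_cast h1
      have h2' : -1 < M := by exact_mod_cast h2
      lia
    have ht0 : t = 0 := by
      rw [hM0] at hM
      have : t * (1 + e - t * e) = 0 := by push_cast at hM; linarith
      rcases mul_eq_zero.1 this with h1 | h1
      · exact h1
      · linarith
    have hδt := htt ht0
    rw [ht0] at L1 L2
    simp only [zero_mul, neg_zero, sub_zero] at L1 L2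
    have hg : ∀ᶠ s in (𝓕 : Filter S), h s = g (U s).toNat := by
      filter_upwards [hUp, hMe] with s h1 h2
      rw [hM0] at h2
      have h3 : (u s : ℝ) ^ 2 - T (U s).toNat = 0 := by exact_mod_cast h2
      rw [hh, h1]
      rw [T_eq] at h3
      linarith
    have hkb : ∀ᶠ s in (𝓕 : Filter S), -3 ≤ 2 * δ s - U s := by
      filter_upwards [hUp, hg, L1.eventually_lt_const (show -(1 + e) < -0.9 by norm_num; linarith)]
        with s h1 h2 h3
      have h4 := g_bound (U s).toNat
      rw [← h1, ← h2] at h4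
      by_contra hc
      have h5 : α ^ (2 * δ s - U s) ≤ α ^ (-4 : ℤ) := zpow_le_zpow_right₀ α_one.le (by lia)
      have h6 : α ^ (-4 : ℤ) < 0.13 := by
        have : α ^ (-4 : ℤ) = (α⁻¹) ^ 4 := by simp [zpow_neg]
        rw [this]
        calc (α⁻¹) ^ 4 < 0.6 ^ 4 := by
              have := inv_pos.2 α_pos
              have := inv_lt
              gcongr
          _ < 0.13 := by norm_num
      have h7 : (α ^ δ s * h s) ^ 2 = α ^ (2 * δ s - U s) * (α ^ U s * h s ^ 2) := by
        rw [← mul_assoc, ← zpow_add₀ α_ne, mul_pow, ← zpow_natCast, ← zpow_mul]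
        congr 2; push_cast; ring
      have h8 : 0 < α ^ (2 * δ s - U s) := zpow_pos α_pos _
      nlinarith [mul_le_mul_of_nonneg_left h4 h8.le]
    have hUz : Tendsto (fun s => U s - z s) 𝓕 atBot := by
      refine tendsto_atBot_mono (fun s => ?_) (tendsto_neg_atBot_iff.2 hδt)
      have := hU s; have := hδ s; have := hδ1 s; have := hε1 s; have := hε s
      lia
    have A1 := mul_g (l := 𝓕) (fun s => U s - δ s) x (by
      refine tendsto_atBot_mono' _ ?_ (tendsto_atBot_add_const_right _ 3 (tendsto_neg_atBot_iff.2 hδt))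
      filter_upwards [hkb] with s hs
      have := hU s; have := hδ s
      lia)
    have A2 := mul_g (l := 𝓕) (fun s => U s - δ s - ε s) y (by
      refine tendsto_atBot_mono' _ ?_ (tendsto_atBot_add_const_right _ 3 (tendsto_neg_atBot_iff.2 hδt))
      filter_upwards [hkb] with s hs
      have := hU s; have := hδ s; have := hε1 s; have := hε s
      lia)
    have A3 := mul_g (l := 𝓕) (fun s => U s - 2 * δ s - ε s) z (by
      refine tendsto_atBot_mono' _ ?_ (tendsto_atBot_add_const_right _ 6 (tendsto_neg_atBot_iff.2 hzZ))
      filter_upwards [hkb] with s hs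
      have := hε1 s
      lia)
    have A4 := zpow_bot _ hUz
    have A5 := zpow_bot _ (tendsto_neg_atBot_iff.2 hUt)
    have main : Tendsto (fun s => (R (U s).toNat : ℝ) + 44 * (κ * α ^ (U s - δ s)
        + κ * α ^ (U s - δ s - ε s) - κ * α ^ (U s - 2 * δ s - ε s))) 𝓕 (𝓝 0) := by
      have h1 := (((((A1.add A2).sub A3).add (A4.mul ((ox.mul oy).mul_const D))).add
        (A4.mul ((L2.mul oz).mul_const D))).const_mul (44 * κ)).add (A5.mul_const D)
      have h2 : 44 * κ * (0 + 0 - 0 + 0 * (1 * 1 * D) + 0 * (0 * 1 * D)) + 0 * D = 0 := by ring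
      rw [h2] at h1
      refine h1.congr' ?_
      filter_upwards [hUp, hg] with s s1 s2
      have s3 := exact1 s
      rw [R_eq, ← s2, ← s1, inv_pow, ← s1, zpow_neg]
      have s4 : ρ s = 1 - (1 - g (z s)) * D * α ^ (-(z s : ℤ)) := by
        have hp3 : α ^ (z s) ≠ 0 := pow_ne_zero _ α_ne
        rw [hρ, T_eq, zpow_neg, zpow_natCast, ← Dκ]
        field_simp
        ring
      have s5 : α ^ (U s - δ s - ε s) = α ^ (U s - δ s) * α ^ (-ε s) := by
        rw [← zpow_add₀ α_ne]; congr 1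
      have s6 : α ^ (U s - 2 * δ s - ε s) = α ^ (U s - δ s) * (α ^ (-δ s) * α ^ (-ε s)) := by
        rw [← zpow_add₀ α_ne, ← zpow_add₀ α_ne]; congr 1; ring
      have s7 : α ^ (U s - z s) = α ^ (U s - δ s) * α ^ (-(y s : ℤ)) := by
        rw [← zpow_add₀ α_ne]; congr 1; rw [hδ]; ring
      have s8 : α ^ U s = α ^ (U s - δ s) * α ^ δ s := by
        rw [← zpow_add₀ α_ne]; congr 1; ring
      have s9 : α ^ (U s - z s) = α ^ U s * α ^ (-(z s : ℤ)) := by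
        rw [← zpow_add₀ α_ne]; congr 1
      have s10 : α ^ U s * h s + α ^ (U s - δ s) + α ^ (U s - δ s - ε s)
          - α ^ (U s - 2 * δ s - ε s) =
          α ^ (U s - δ s) * g (x s) + α ^ (U s - δ s - ε s) * g (y s)
          - α ^ (U s - 2 * δ s - ε s) * g (z s)
          + α ^ (U s - z s) * ((1 - g (x s)) * (1 - g (y s)) * D)
          + α ^ (U s - z s) * (h s * (1 - g (z s)) * D) := by
        have s11 : α ^ U s * h s * ρ s = α ^ U s * h s
            - α ^ (U s - z s) * (h s * (1 - g (z s)) * D) := by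
          rw [s4, s9]; ring
        have s12 : α ^ U s * h s * ρ s = α ^ (U s - δ s) * (α ^ δ s * h s * ρ s) := by
          rw [s8]; ring
        rw [s12, s3] at s11
        rw [s7] at s11 ⊢
        rw [s5, s6]
        linear_combination -s11
      linear_combination (-44 * κ) * s10
    obtain ⟨N1, p1, q1, r1, B1⟩ := approx 𝓕 (fun s => U s - δ s)
    obtain ⟨N2, p2, q2, r2, B2⟩ := approx 𝓕 (fun s => U s - δ s - ε s)
    obtain ⟨N3, p3, q3, r3, B3⟩ := approx 𝓕 (fun s => U s - 2 * δ s - ε s)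
    have C := main.sub (((B1.add B2).sub B3).const_mul 44)
    obtain ⟨m, hm, hme⟩ := int_conv 𝓕 (fun s => R (U s).toNat + 44 * (N1 s + N2 s - N3 s)) _
      (C.congr fun s => by push_cast; ring)
    have h4 : m * D = -44 * ((p1 + q1 * α + r1 * α ^ 2) + (p2 + q2 * α + r2 * α ^ 2)
        - (p3 + q3 * α + r3 * α ^ 2)) := by
      rw [hm]
      linear_combination (-44 * ((p1 + q1 * α + r1 * α ^ 2) + (p2 + q2 * α + r2 * α ^ 2)
        - (p3 + q3 * α + r3 * α ^ 2))) * κD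
    unfold D at h4
    have h5 := lin_indep (44 * (p1 + p2 - p3) - m) (44 * (q1 + q2 - q3) - 2 * m)
      (44 * (r1 + r2 - r3) + 3 * m) (by push_cast; linarith)
    obtain ⟨s, hs⟩ := hme.exists
    apply R_not (U s).toNat
    have := h5.2.2
    lia

end Trib

open Filter

/-- There are only finitely many triples of integers `1 ≤ u < v < w` such that
`1 + u*v`, `1 + u*w` and `1 + v*w` are all Tribonacci numbers. -/
theorem finitely_many_tribonacci_diophantine_triples :
    {t : ℤ × ℤ × ℤ | 1 ≤ t.1 ∧ t.1 < t.2.1 ∧ t.2.1 < t.2.2 ∧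
      ∃ x y z : ℕ, 0 < x ∧ 0 < y ∧ 0 < z ∧
        1 + t.1 * t.2.1 = (T x : ℤ) ∧ 1 + t.1 * t.2.2 = (T y : ℤ) ∧
        1 + t.2.1 * t.2.2 = (T z : ℤ)}.Finite := by
  by_contra hinf
  set A := {t : ℤ × ℤ × ℤ | 1 ≤ t.1 ∧ t.1 < t.2.1 ∧ t.2.1 < t.2.2 ∧
      ∃ x y z : ℕ, 0 < x ∧ 0 < y ∧ 0 < z ∧
        1 + t.1 * t.2.1 = (T x : ℤ) ∧ 1 + t.1 * t.2.2 = (T y : ℤ) ∧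
        1 + t.2.1 * t.2.2 = (T z : ℤ)} with hA
  have hI : Infinite A := Set.infinite_coe_iff.2 hinf
  have hP : ∀ s : A, 1 ≤ s.1.1 ∧ s.1.1 < s.1.2.1 ∧ s.1.2.1 < s.1.2.2 ∧
      ∃ x y z : ℕ, 0 < x ∧ 0 < y ∧ 0 < z ∧
        1 + s.1.1 * s.1.2.1 = (T x : ℤ) ∧ 1 + s.1.1 * s.1.2.2 = (T y : ℤ) ∧
        1 + s.1.2.1 * s.1.2.2 = (T z : ℤ) := fun s => s.2
  choose hu huv hvw x y z _ _ _ hx hy hz using hP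
  let 𝓕 : Ultrafilter A := hyperfilter A
  have hw : ∀ b : ℤ, ∀ᶠ s : A in (𝓕 : Filter A), b < s.1.2.2 := by
    intro b
    have hfin : {s : A | ¬ b < s.1.2.2}.Finite := by
      have h1 : (Set.Icc (1 : ℤ) b ×ˢ (Set.Icc (1 : ℤ) b ×ˢ Set.Icc (1 : ℤ) b)).Finite :=
        (Set.finite_Icc _ _).prod ((Set.finite_Icc _ _).prod (Set.finite_Icc _ _))
      refine (h1.preimage (Subtype.val_injective (p := (· ∈ A))).injOn).subset ?_
      intro s hs
      have := hu s; have := huv s; have := hvw s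
      simp only [Set.mem_ofPred_eq] at hs
      simp only [Set.mem_preimage, Set.mem_prod, Set.mem_Icc]
      lia
    have := hfin.compl_mem_cofinite
    have h2 := hyperfilter_le_cofinite this
    filter_upwards [h2] with s hs
    simpa using hs
  have lt_of (m n : ℕ) (h : (T m : ℤ) < T n) : m < n :=
    Trib.T_mono.reflect_lt (by exact_mod_cast h)
  have hxy : ∀ s, x s < y s := fun s => lt_of _ _ (by
    rw [← hx, ← hy]; have := hu s; have := hvw s; nlinarith)
  have hyz : ∀ s, y s < z s := fun s => lt_of _ _ (by
    rw [← hy, ← hz]; have := hu s; have := huv s; have := hvw s; nlinarith)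
  have hyt : Tendsto y 𝓕 atTop := by
    rw [tendsto_atTop]
    intro b
    filter_upwards [hw (T b)] with s hs
    refine (lt_of _ _ ?_).le
    rw [← hy]; have := hu s; have := huv s; have := hvw s; nlinarith
  have hzt : Tendsto z 𝓕 atTop := tendsto_atTop_mono (fun s => (hyz s).le) hyt
  rcases Trib.dich_lb 𝓕 (fun s => (x s : ℤ)) 0 (Eventually.of_forall fun s => by lia) with
    ⟨d, hd⟩ | hxt
  · refine Trib.case_const 𝓕 (fun s => s.1.1) (fun s => s.1.2.1) x y z hu huv hx hyz ?_ hyt hzt d hd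
    intro s
    rw [← hy, ← hz]; ring
  · refine Trib.case_inf 𝓕 (fun s => s.1.1) x y z hu hxy hyz ?_ ?_ hyt hzt
    · intro s
      rw [← hx, ← hy, ← hz]; ring
    · exact tendsto_natCast_atTop_iff.1 hxt
end

section
/- If y and z are integers with 4 ≤ y < z, then gcd(T_y − 1, T_z − 1) < α^{3z/4}. -/
theorem T_rec (n : ℕ) : T (n + 3) = T (n + 2) + T (n + 1) + T n := by rw [T]

theorem alpha_bounds (α : ℝ) (h : α ^ 3 = α ^ 2 + α + 1) : 1.839 < α ∧ α < 1.84 := by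
  constructor
  · by_contra hc
    push Not at hc
    nlinarith [sq_nonneg (α + 0.42), sq_nonneg α, mul_nonneg (sub_nonneg.2 hc) (sq_nonneg (α + 0.42))]
  · by_contra hc
    push Not at hc
    nlinarith [mul_nonneg (sub_nonneg.2 hc) (sq_nonneg (α + 0.42))]

theorem T_le (α : ℝ) (h : α ^ 3 = α ^ 2 + α + 1) (h1 : 1.839 < α) (n : ℕ) :
    (T (n + 2) : ℝ) ≤ α ^ n ∧ (T (n + 3) : ℝ) ≤ α ^ (n + 1) ∧ (T (n + 4) : ℝ) ≤ α ^ (n + 2) := by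
  induction n with
  | zero =>
    simp only [T]
    norm_num
    constructor
    · linarith
    · nlinarith
  | succ k ih =>
    obtain ⟨a, b, c⟩ := ih
    refine ⟨b, c, ?_⟩
    have : T (k + 1 + 4) = T (k + 4) + T (k + 3) + T (k + 2) := T_rec (k + 2)
    rw [this]
    push_cast
    have e : α ^ (k + 1 + 2) = α ^ (k + 2) + α ^ (k + 1) + α ^ k := by
      linear_combination α ^ k * h
    linarith

theorem T_lt (y z : ℕ) (hy : 4 ≤ y) (hyz : y < z) : 2 ≤ T y ∧ T y < T z := by
  have key : ∀ n, 2 ≤ T (n + 4) ∧ 1 ≤ T (n + 3) ∧ 1 ≤ T (n + 2) := by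
    intro n
    induction n with
    | zero => simp [T]
    | succ k ih =>
      have : T (k + 1 + 4) = T (k + 4) + T (k + 3) + T (k + 2) := T_rec (k + 2)
      have e2 : T (k + 1 + 3) = T (k + 4) := rfl
      have e3 : T (k + 1 + 2) = T (k + 3) := rfl
      omega
  have mono : StrictMono (fun n => T (n + 4)) := by
    apply strictMono_nat_of_lt_succ
    intro k
    have : T (k + 1 + 4) = T (k + 4) + T (k + 3) + T (k + 2) := T_rec (k + 2)
    have := key k
    show T (k + 4) < T (k + 1 + 4)
    omega
  obtain ⟨a, rfl⟩ := Nat.exists_eq_add_of_le' hy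
  obtain ⟨b, rfl⟩ := Nat.exists_eq_add_of_le' (show 4 ≤ z by omega)
  exact ⟨(key a).1, mono (by omega)⟩

theorem Q_bound (α : ℝ) (h : α ^ 3 = α ^ 2 + α + 1) (h1 : 1.839 < α) (h2 : α < 1.84) (n : ℕ) :
    α * (α * T (n + 3) - T (n + 4)) ^ 2 +
      (α ^ 2 - α) * (α * T (n + 2) - T (n + 3)) * (α * T (n + 3) - T (n + 4)) +
      (α * T (n + 2) - T (n + 3)) ^ 2 ≤ 0.6 ∧ |α * T (n + 2) - T (n + 3)| ≤ 1 := by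
  have aux : ∀ x y : ℝ, α * y ^ 2 + (α ^ 2 - α) * x * y + x ^ 2 ≤ 0.6 → |x| ≤ 1 := by
    intro x y hxy
    have e : (α - 1) ^ 2 ≤ 0.71 := by nlinarith
    rw [abs_le_one_iff_mul_self_le_one]
    have k1 : 0 ≤ α * (y + (α - 1) * x / 2) ^ 2 := by positivity
    have k2 : α * (α - 1) ^ 2 / 4 ≤ 0.35 := by nlinarith
    nlinarith [mul_nonneg (sub_nonneg.2 k2) (sq_nonneg x)]
  have key : α * (α * T (n + 3) - T (n + 4)) ^ 2 +
      (α ^ 2 - α) * (α * T (n + 2) - T (n + 3)) * (α * T (n + 3) - T (n + 4)) +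
      (α * T (n + 2) - T (n + 3)) ^ 2 ≤ 0.6 := by
    induction n with
    | zero =>
      simp only [T]
      norm_num
      nlinarith [mul_pos (sub_pos.2 h1) (sub_pos.2 h2)]
    | succ k ih =>
      have e5 : (T (k + 1 + 4) : ℝ) = T (k + 4) + T (k + 3) + T (k + 2) := by
        exact_mod_cast T_rec (k + 2)
      rw [e5]
      have e2 : T (k + 1 + 3) = T (k + 4) := rfl
      have e3 : T (k + 1 + 2) = T (k + 3) := rfl
      rw [e2, e3]
      generalize (T (k + 4) : ℝ) = c at *
      generalize (T (k + 3) : ℝ) = b at *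
      generalize (T (k + 2) : ℝ) = a at *
      have r : α * (α * c - (c + b + a)) = - (α ^ 2 - α) * (α * b - c) - (α * a - b) := by
        linear_combination b * h
      generalize (α * c - (c + b + a)) = w at *
      generalize (α * b - c) = v at *
      generalize (α * a - b) = u at *
      have q0 : 0 ≤ α * w ^ 2 + (α ^ 2 - α) * v * w + v ^ 2 := by
        have k1 : 0 ≤ α * (w + (α - 1) * v / 2) ^ 2 := by positivity
        have e : (α - 1) ^ 2 ≤ 0.71 := by nlinarith
        have k2 : α * (α - 1) ^ 2 / 4 ≤ 0.35 := by nlinarith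
        nlinarith [mul_nonneg (sub_nonneg.2 k2) (sq_nonneg v)]
      have q1 : α * (α * w ^ 2 + (α ^ 2 - α) * v * w + v ^ 2) =
          α * v ^ 2 + (α ^ 2 - α) * u * v + u ^ 2 := by
        linear_combination (α * w - u) * r 
      nlinarith
  exact ⟨key, aux _ _ key⟩

theorem eta_bound (α : ℝ) (h : α ^ 3 = α ^ 2 + α + 1) (h1 : 1.839 < α) (h2 : α < 1.84)
    (y n : ℕ) (hy : 2 ≤ y) : |α ^ n * T y - T (y + n)| ≤ 2 * (α ^ n - 1) := by
  induction n with
  | zero => simp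
  | succ k ih =>
    obtain ⟨m, hm⟩ := Nat.exists_eq_add_of_le' (show 2 ≤ y + k by omega)
    have := (Q_bound α h h1 h2 m).2
    rw [hm] at ih
    have e : y + (k + 1) = m + 3 := by omega
    rw [e]
    rw [abs_le] at *
    have p : 1 ≤ α ^ k := one_le_pow₀ (by linarith)
    rw [pow_succ]
    constructor <;> nlinarith

theorem exists_beta (α : ℝ) (h1 : 1.839 < α) (h2 : α < 1.84) :
    ∃ β γ : ℂ, β + γ = 1 - α ∧ α * β * γ = 1 ∧ ‖β‖ ≤ 1 ∧ ‖γ‖ ≤ 1 := by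
  have hd : 0 ≤ 4 / α - (1 - α) ^ 2 := by
    have : 2 ≤ 4 / α := by rw [le_div_iff₀ (by linarith)]; linarith
    nlinarith
  set s := Real.sqrt (4 / α - (1 - α) ^ 2) with hs
  have hss : s ^ 2 = 4 / α - (1 - α) ^ 2 := Real.sq_sqrt hd
  have hle : 4 / α ≤ 4 := by rw [div_le_iff₀ (by linarith)]; linarith
  have hα : α * (4 / α) = 4 := by field_simp
  refine ⟨⟨(1 - α) / 2, s / 2⟩, ⟨(1 - α) / 2, -(s / 2)⟩, ?_, ?_, ?_, ?_⟩
  · apply Complex.ext <;> simp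
  · apply Complex.ext
    · simp
      linear_combination α / 4 * hss + hα / 4
    · simp
      ring
  · rw [← sq_le_one_iff₀ (norm_nonneg _), ← Complex.normSq_eq_norm_sq, Complex.normSq_mk]
    nlinarith
  · rw [← sq_le_one_iff₀ (norm_nonneg _), ← Complex.normSq_eq_norm_sq, Complex.normSq_mk]
    nlinarith

theorem int_sum (x y z : ℂ) (r s t : ℤ) (hx : x ^ 3 = r * x ^ 2 + s * x + t)
    (hy : y ^ 3 = r * y ^ 2 + s * y + t) (hz : z ^ 3 = r * z ^ 2 + s * z + t)
    (a b : ℤ) (h1 : x + y + z = a) (h2 : x ^ 2 + y ^ 2 + z ^ 2 = b) (n : ℕ) :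
    ∃ A : ℤ, x ^ n + y ^ n + z ^ n = A := by
  have : ∀ n : ℕ, (∃ A : ℤ, x ^ n + y ^ n + z ^ n = A) ∧
      (∃ A : ℤ, x ^ (n + 1) + y ^ (n + 1) + z ^ (n + 1) = A) ∧
      (∃ A : ℤ, x ^ (n + 2) + y ^ (n + 2) + z ^ (n + 2) = A) := by
    intro n
    induction n with
    | zero => exact ⟨⟨3, by norm_num⟩, ⟨a, by simpa using h1⟩, ⟨b, by simpa using h2⟩⟩
    | succ k ih =>
      obtain ⟨⟨A, hA⟩, ⟨B, hB⟩, ⟨C, hC⟩⟩ := ih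
      refine ⟨⟨B, hB⟩, ⟨C, hC⟩, ⟨r * C + s * B + t * A, ?_⟩⟩
      push_cast
      rw [← hA, ← hB, ← hC]
      linear_combination x ^ k * hx + y ^ k * hy + z ^ k * hz
  exact (this n).1

theorem gcd_cube (p q A B : ℤ) (hp : 0 < p) (hpq : p < q) :
    ((Int.gcd p q : ℤ)) ^ 3 ≤ |p ^ 3 - p ^ 2 * q * B + p * q ^ 2 * A - q ^ 3| := by
  obtain ⟨p', q', hco, e1, e2⟩ := Int.exists_gcd_one (m := p) (n := q)
    (Int.gcd_pos_of_ne_zero_left _ hp.ne')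
  have hd : (0 : ℤ) < Int.gcd p q := by
    exact_mod_cast Int.gcd_pos_of_ne_zero_left _ hp.ne'
  generalize (Int.gcd p q : ℤ) = d at *
  have hco' : IsCoprime p' q' := Int.isCoprime_iff_gcd_eq_one.2 hco
  have hp' : 0 < p' := by
    subst e1; exact pos_of_mul_pos_left hp hd.le
  have hpq' : p' < q' := by
    rw [e1, e2] at hpq; exact lt_of_mul_lt_mul_right hpq hd.le
  have e : p ^ 3 - p ^ 2 * q * B + p * q ^ 2 * A - q ^ 3 =
      d ^ 3 * (p' ^ 3 - p' ^ 2 * q' * B + p' * q' ^ 2 * A - q' ^ 3) := by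
    rw [e1, e2]; ring
  rw [e, abs_mul, abs_of_pos (by positivity : 0 < d ^ 3)]
  have hne : p' ^ 3 - p' ^ 2 * q' * B + p' * q' ^ 2 * A - q' ^ 3 ≠ 0 := by
    intro h0
    have : q' ∣ p' ^ 3 := ⟨p' ^ 2 * B - p' * q' * A + q' ^ 2, by linear_combination h0⟩
    have u : IsUnit q' := (hco'.symm.pow_right (n := 3)).isUnit_of_dvd' dvd_rfl this
    rcases Int.isUnit_iff.1 u with u | u <;> omega
  have : 1 ≤ |p' ^ 3 - p' ^ 2 * q' * B + p' * q' ^ 2 * A - q' ^ 3| := Int.one_le_abs hne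
  nlinarith [pow_pos hd 3]

theorem norm_bound (α : ℝ) (h : α ^ 3 = α ^ 2 + α + 1) (h1 : 1.839 < α) (h2 : α < 1.84)
    (p q : ℤ) (hp : 0 < p) (hpq : p < q) (n : ℕ) :
    ((Int.gcd p q : ℝ)) ^ 3 ≤ |p * α ^ n - q| * (p + q) ^ 2 := by
  obtain ⟨β, γ, hs, hm, hβ, hγ⟩ := exists_beta α h1 h2
  have hc : (α : ℂ) ^ 3 = α ^ 2 + α + 1 := by exact_mod_cast h
  have hα0 : (α : ℂ) ≠ 0 := by
    have : α ≠ 0 := by linarith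
    exact_mod_cast this
  have hγe : γ = 1 - α - β := by linear_combination hs
  have hbg : β * γ = α ^ 2 - α - 1 := by
    apply mul_left_cancel₀ hα0
    linear_combination hm - hc
  have quad : ∀ w : ℂ, w ^ 2 = (1 - α) * w - (α ^ 2 - α - 1) → w ^ 3 = w ^ 2 + w + 1 := by
    intro w hw
    linear_combination (w - α) * hw + hc
  have hb3 : β ^ 3 = β ^ 2 + β + 1 := quad β (by
    linear_combination β * hs - hbg)
  have hg3 : γ ^ 3 = γ ^ 2 + γ + 1 := quad γ (by
    linear_combination γ * hs - hbg)
  have inv : ∀ r w : ℂ, r * w = 1 → w ^ 3 = w ^ 2 + w + 1 → r ^ 3 = - r ^ 2 - r + 1 := by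
    intro r w hr hw
    have a2 : r ^ 2 * w ^ 2 = 1 := by rw [← mul_pow, hr, one_pow]
    have a3 : r ^ 3 * w ^ 3 = 1 := by rw [← mul_pow, hr, one_pow]
    linear_combination - r ^ 3 * hw + a3 - r * a2 - r ^ 2 * hr
  have i1 := inv (α * β) γ hm hg3
  have i2 := inv (α * γ) β (by linear_combination hm) hb3
  have i3 := inv (β * γ) α (by linear_combination hm) hc
  have E1 : (α : ℂ) + β + γ = 1 := by linear_combination hs
  have E2 : (α : ℂ) * β + α * γ + β * γ = -1 := by linear_combination hbg + α * hs
  obtain ⟨A, hA⟩ := int_sum α β γ 1 1 1 (by simpa using hc) (by simpa using hb3)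
    (by simpa using hg3) 1 3 (by simpa using E1)
    (by push_cast; linear_combination (α + β + γ + 1) * E1 - 2 * E2) n
  obtain ⟨B, hB⟩ := int_sum (α * β) (α * γ) (β * γ) (-1) (-1) 1
    (by push_cast; linear_combination i1) (by push_cast; linear_combination i2)
    (by push_cast; linear_combination i3) (-1) (-1) (by simpa using E2)
    (by push_cast; linear_combination (α * β + α * γ + β * γ - 1) * E2
          - 2 * (α * β * γ) * E1 - 2 * hm) n
  have hN := gcd_cube p q A B hp hpq
  have hmn : (α : ℂ) ^ n * β ^ n * γ ^ n = 1 := by rw [← mul_pow, ← mul_pow, hm, one_pow]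
  simp only [mul_pow] at hB
  have hfac : (((p ^ 3 - p ^ 2 * q * B + p * q ^ 2 * A - q ^ 3 : ℤ) : ℝ) : ℂ) =
      ((p * α ^ n - q : ℝ) : ℂ) * ((p * β ^ n - q) * (p * γ ^ n - q)) := by
    push_cast
    rw [← hA, ← hB]
    linear_combination - p ^ 3 * hmn
  have hfac' := congrArg norm hfac
  rw [norm_mul, norm_mul, Complex.norm_real, Complex.norm_real, Real.norm_eq_abs,
    Real.norm_eq_abs] at hfac'
  have bd : ∀ w : ℂ, ‖w‖ ≤ 1 → ‖(p : ℂ) * w ^ n - q‖ ≤ p + q := by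
    intro w hw
    have hp' : (0 : ℝ) < p := by exact_mod_cast hp
    have hq' : (0 : ℝ) < q := by exact_mod_cast hp.trans hpq
    refine (norm_sub_le _ _).trans ?_
    rw [norm_mul, norm_pow, Complex.norm_intCast, Complex.norm_intCast, abs_of_pos hp',
      abs_of_pos hq']
    have := pow_le_one₀ (n := n) (norm_nonneg w) hw
    nlinarith
  have hN' : ((Int.gcd p q : ℝ)) ^ 3 ≤
      |((p ^ 3 - p ^ 2 * q * B + p * q ^ 2 * A - q ^ 3 : ℤ) : ℝ)| := by exact_mod_cast hN
  rw [hfac'] at hN'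
  refine hN'.trans ?_
  rw [pow_two]
  have := bd β hβ
  have := bd γ hγ
  gcongr
  exact (norm_nonneg _).trans this

/-- If `4 ≤ y < z`, then `gcd (T y - 1) (T z - 1) < α ^ (3*z/4)`, where `α` is the
unique real root of `x³ - x² - x - 1`. -/
theorem gcd_tribonacci_sub_one_lt (α : ℝ) (hα : α ^ 3 = α ^ 2 + α + 1)
    (y z : ℕ) (hy : 4 ≤ y) (hyz : y < z) :
    (Int.gcd ((T y : ℤ) - 1) ((T z : ℤ) - 1) : ℝ) < α ^ ((3 * z : ℝ) / 4) := by
  obtain ⟨h1, h2⟩ := alpha_bounds α hα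
  obtain ⟨ht, htz⟩ := T_lt y z hy hyz
  have hp : (0 : ℤ) < (T y : ℤ) - 1 := by omega
  have hpq : (T y : ℤ) - 1 < (T z : ℤ) - 1 := by omega
  obtain ⟨n, rfl⟩ := Nat.exists_eq_add_of_le hyz.le
  have hTy : (T y : ℝ) ≤ α ^ (y - 2) := by
    have := (T_le α hα h1 (y - 2)).1
    rwa [Nat.sub_add_cancel (by omega)] at this
  have hTz : (T (y + n) : ℝ) ≤ α ^ (y + n - 2) := by
    have := (T_le α hα h1 (y + n - 2)).1
    rwa [Nat.sub_add_cancel (by omega)] at this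
  have hα1 : 1 ≤ α := by linarith
  by_cases hc : 4 * n ≤ y + n
  · have hN := norm_bound α hα h1 h2 _ _ hp hpq n
    generalize (Int.gcd ((T y : ℤ) - 1) ((T (y + n) : ℤ) - 1) : ℝ) = d at *
    push_cast at hN
    have hE := eta_bound α hα h1 h2 y n (by omega)
    have hpow : 1 ≤ α ^ n := one_le_pow₀ hα1
    have hη : |((T y : ℝ) - 1) * α ^ n - (T (y + n) - 1)| ≤ α ^ (n + 2) := by
      rw [pow_add]
      rw [abs_le] at *
      have : 3 ≤ α ^ 2 := by nlinarith
      constructor <;> nlinarith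
    have hsum : (T y : ℝ) - 1 + (T (y + n) - 1) < α ^ (y + n - 1) := by
      have l : α ^ (y - 2) ≤ α ^ (y + n - 3) := pow_le_pow_right₀ hα1 (by omega)
      obtain ⟨m, hm⟩ := Nat.exists_eq_add_of_le' (show 3 ≤ y + n by omega)
      rw [hm] at l hTz ⊢
      simp only [show m + 3 - 3 = m by omega, show m + 3 - 2 = m + 1 by omega,
        show m + 3 - 1 = m + 2 by omega] at *
      have : 0 < α ^ m := by positivity
      have e : α ^ (m + 1) + α ^ m ≤ α ^ (m + 2) := by
        rw [pow_add, pow_add]; nlinarith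
      linarith
    have hpos : 0 < (T y : ℝ) - 1 + (T (y + n) - 1) := by
      have : (2 : ℝ) ≤ T y := by exact_mod_cast ht
      have : (T y : ℝ) < T (y + n) := by exact_mod_cast htz
      linarith
    have hfin : d ^ 3 < α ^ (n + 2 * (y + n)) := by
      calc d ^ 3 ≤ _ := hN
        _ ≤ α ^ (n + 2) * ((T y : ℝ) - 1 + (T (y + n) - 1)) ^ 2 := by gcongr
        _ < α ^ (n + 2) * (α ^ (y + n - 1)) ^ 2 := by gcongr
        _ = α ^ (n + 2 * (y + n)) := by
          rw [← pow_mul, ← pow_add]; congr 1; omega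
    refine lt_of_pow_lt_pow_left₀ 3 (by positivity) (hfin.trans_le ?_)
    rw [← Real.rpow_natCast, ← Real.rpow_natCast, ← Real.rpow_mul (by linarith)]
    apply Real.rpow_le_rpow_of_exponent_le hα1
    have : (4 * n : ℝ) ≤ y + n := by exact_mod_cast hc
    push_cast
    linarith
  · have hg : (Int.gcd ((T y : ℤ) - 1) ((T (y + n) : ℤ) - 1) : ℤ) ≤ (T y : ℤ) - 1 :=
      Int.le_of_dvd hp (Int.gcd_dvd_left ..)
    have hg' : (Int.gcd ((T y : ℤ) - 1) ((T (y + n) : ℤ) - 1) : ℝ) ≤ (T y : ℝ) - 1 := by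
      exact_mod_cast hg
    have : α ^ (y - 2) ≤ α ^ ((3 * (y + n : ℕ) : ℝ) / 4) := by
      rw [← Real.rpow_natCast]
      apply Real.rpow_le_rpow_of_exponent_le hα1
      have : (y + n : ℝ) < 4 * n := by exact_mod_cast (not_le.1 hc)
      rw [Nat.cast_sub (by omega)]
      push_cast
      linarith
    linarith
end

section
/- The element a = 1/((α − β)(α − γ)) is not a square in K; that is, there is no element t ∈ K with t² = a. -/
open Polynomial in
lemma trib_irred : Irreducible (X ^ 3 - X ^ 2 - X - 1 : ℚ[X]) := by
  have hd : (X ^ 3 - X ^ 2 - X - 1 : ℚ[X]).natDegree = 3 := by compute_degree!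
  have hm : (X ^ 3 - X ^ 2 - X - 1 : ℚ[X]).Monic := by monicity!
  rw [hm.irreducible_iff_roots_eq_zero_of_degree_le_three (by omega) (by omega)]
  rw [Multiset.eq_zero_iff_forall_notMem]
  intro q hq
  have hq' := (mem_roots'.1 hq).2
  simp only [IsRoot.def, eval_sub, eval_pow, eval_X, eval_one] at hq'
  have hm2 : (X ^ 3 - X ^ 2 - X - 1 : ℤ[X]).Monic := by monicity!
  obtain ⟨n, hn⟩ := isInteger_of_is_root_of_monic (K := ℚ) (r := q) hm2 (by simpa using hq')
  simp only [algebraMap_int_eq, eq_intCast] at hn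
  subst hn
  have h : n * (n ^ 2 - n - 1) = 1 := by
    have : (n : ℚ) * (n ^ 2 - n - 1) = 1 := by linarith
    exact_mod_cast this
  rcases Int.eq_one_or_neg_one_of_mul_eq_one h with rfl | rfl <;> norm_num at h

open Polynomial in
lemma trib_norm (P : ℚ[X]) (h : (X ^ 3 - X ^ 2 - X - 1 : ℚ[X]) ∣ P ^ 2 * (3 * X ^ 2 - 2 * X - 1) - 1) :
    False := by
  obtain ⟨Q, hQ⟩ := h
  let M : Matrix (Fin 3) (Fin 3) ℚ := !![0, 0, 1; 1, 0, 1; 0, 1, 1]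
  have h0 : M ^ 3 - M ^ 2 - M - 1 = 0 := by
    ext i j
    fin_cases i <;> fin_cases j <;> simp [M, pow_succ, Matrix.mul_apply, Fin.sum_univ_three] <;> norm_num
  have h1 := congrArg (aeval M) hQ
  simp only [map_sub, map_mul, map_pow, aeval_X, map_one, map_ofNat, h0, zero_mul] at h1
  have h2 : (3 * M ^ 2 - 2 * M - 1).det = 44 := by
    have : 3 * M ^ 2 - 2 * M - 1 = !![-1, 3, 1; -2, 2, 4; 3, 1, 3] := by
      have e3 : (3 : Matrix (Fin 3) (Fin 3) ℚ) = (3 : ℚ) • 1 := by ext i j; fin_cases i <;> fin_cases j <;> simp [Matrix.ofNat_apply]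
      have e2 : (2 : Matrix (Fin 3) (Fin 3) ℚ) = (2 : ℚ) • 1 := by ext i j; fin_cases i <;> fin_cases j <;> simp [Matrix.ofNat_apply]
      rw [e3, e2]
      ext i j
      fin_cases i <;> fin_cases j <;> simp [M, pow_succ, Matrix.mul_apply, Fin.sum_univ_three] <;> norm_num
    rw [this, Matrix.det_fin_three]
    simp; norm_num
  have h3 := congrArg Matrix.det (sub_eq_zero.1 h1)
  rw [Matrix.det_mul, Matrix.det_pow, h2, Matrix.det_one] at h3
  set d := (aeval M P).det
  have h4 : IsSquare (11 : ℚ) := ⟨1 / (2 * d), by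
    have : d ≠ 0 := by rintro hd; simp [hd] at h3
    field_simp; linarith⟩
  have h5 : IsSquare (11 : ℤ) := by
    rw [← Rat.isSquare_intCast_iff]; exact_mod_cast h4
  obtain ⟨r, hr⟩ := h5
  have : r < 4 := by nlinarith
  have : -4 < r := by nlinarith
  interval_cases r <;> omega

open Polynomial in
lemma trib_rep (α β : ℂ) (hα : α ^ 3 = α ^ 2 + α + 1) (hβ : β ^ 3 = β ^ 2 + β + 1)
    (hq : β ^ 2 = (1 - α) * β - (α ^ 2 - α - 1)) (t : ℂ)
    (ht : t ∈ IntermediateField.adjoin ℚ {α, β}) :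
    ∃ P Q : ℚ[X], t = aeval α P + aeval α Q * β := by
  have halg : ∀ x : ℂ, x ^ 3 = x ^ 2 + x + 1 → IsAlgebraic ℚ x := fun x hx =>
    ⟨X ^ 3 - X ^ 2 - X - 1, trib_irred.ne_zero, by simp [hx]; ring⟩
  rw [← IntermediateField.mem_toSubalgebra, IntermediateField.adjoin_toSubalgebra_of_isAlgebraic
    (by rintro x (rfl | rfl); exacts [halg _ hα, halg _ hβ])] at ht
  induction ht using Algebra.adjoin_induction with
  | mem x hx =>
    rcases hx with rfl | rfl
    · exact ⟨X, 0, by simp⟩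
    · exact ⟨0, 1, by simp⟩
  | algebraMap r => exact ⟨C r, 0, by simp⟩
  | add x y _ _ hx hy =>
    obtain ⟨P, Q, rfl⟩ := hx
    obtain ⟨R, S, rfl⟩ := hy
    exact ⟨P + R, Q + S, by simp; ring⟩
  | mul x y _ _ hx hy =>
    obtain ⟨P, Q, rfl⟩ := hx
    obtain ⟨R, S, rfl⟩ := hy
    refine ⟨P * R - Q * S * (X ^ 2 - X - 1), P * S + Q * R + Q * S * (1 - X), ?_⟩
    simp only [map_add, map_sub, map_mul, map_pow, aeval_X, map_one]
    linear_combination (aeval α Q * aeval α S) * hq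

/-- The coefficient `a = 1/((α-β)(α-γ))` is not a square in the splitting field
`K = ℚ(α, β)` of `x³ - x² - x - 1`. -/
theorem a_not_square (α : ℝ) (hα : α ^ 3 = α ^ 2 + α + 1)
    (β γ : ℂ) (hβ : β ^ 3 = β ^ 2 + β + 1) (hβim : β.im ≠ 0)
    (hγ : γ = starRingEnd ℂ β) :
    ¬ ∃ t : IntermediateField.adjoin ℚ {(α : ℂ), β},
      (t : ℂ) ^ 2 = 1 / (((α : ℂ) - β) * ((α : ℂ) - γ)) := by
  rintro ⟨⟨t, ht⟩, h⟩
  simp only at h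
  have hαc : (α : ℂ) ^ 3 = α ^ 2 + α + 1 := by exact_mod_cast hα
  have hne : (α : ℂ) - β ≠ 0 := fun h0 => hβim (by
    have := congrArg Complex.im h0
    simpa using this)
  have hq : β ^ 2 = (1 - α) * β - ((α : ℂ) ^ 2 - α - 1) := by
    apply mul_left_cancel₀ hne
    linear_combination hαc - hβ
  have hq2 : γ ^ 2 = (1 - α) * γ - ((α : ℂ) ^ 2 - α - 1) := by
    have := congrArg (starRingEnd ℂ) hq
    simpa [← hγ] using this
  have hne2 : β - γ ≠ 0 := fun h0 => hβim (by
    have := congrArg Complex.im h0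
    simp [hγ] at this
    linarith)
  have hs : β + γ = 1 - α := by
    apply mul_left_cancel₀ hne2
    linear_combination hq - hq2
  have hprod : ((α : ℂ) - β) * (α - γ) = 3 * α ^ 2 - 2 * α - 1 := by
    linear_combination (β - α) * hs - hq
  have hns : ((α : ℂ) - β) * (α - γ) = (Complex.normSq (α - β) : ℝ) := by
    rw [← Complex.mul_conj, hγ]; simp
  have hpos : 0 < Complex.normSq (α - β) := Complex.normSq_pos.2 hne
  have htim : t.im = 0 := by
    rw [hns] at h
    have h' : t ^ 2 = ((1 / Complex.normSq (α - β) : ℝ) : ℂ) := by rw [h]; push_cast; rfl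
    have hp : 0 < 1 / Complex.normSq (α - β) := by positivity
    have hre := congrArg Complex.re h'
    have him := congrArg Complex.im h'
    simp only [pow_two, Complex.mul_re, Complex.mul_im, Complex.ofReal_re, Complex.ofReal_im] at hre him
    have : t.re * t.im = 0 := by linarith
    rcases mul_eq_zero.1 this with h0 | h0
    · rw [h0] at hre; nlinarith [mul_self_nonneg t.im]
    · exact h0
  obtain ⟨P, Q, hPQ⟩ := trib_rep α β hαc hβ hq t ht
  have hre : ∀ R : Polynomial ℚ, Polynomial.aeval (α : ℂ) R = ((Polynomial.aeval α R : ℝ) : ℂ) :=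
    fun R => Polynomial.aeval_algebraMap_apply ℂ α R
  have hQ0 : Polynomial.aeval α Q = 0 := by
    have := congrArg Complex.im hPQ
    rw [hre, hre, htim] at this
    simp at this
    tauto
  have htP : t = Polynomial.aeval (α : ℂ) P := by rw [hPQ, hre Q, hQ0]; simp
  apply trib_norm P
  have hmin := minpoly.eq_of_irreducible_of_monic (x := (α : ℂ)) trib_irred
    (by simp [hαc]; ring) (by monicity!)
  rw [hmin]
  apply minpoly.dvd
  simp only [map_sub, map_mul, map_pow, Polynomial.aeval_X, map_one, map_ofNat]
  rw [← htP, h, ← hprod, one_div, inv_mul_cancel₀, sub_self]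
  rw [hns]; exact_mod_cast hpos.ne'
end

section
/- The element aα, where a = 1/((α − β)(α − γ)), is not a square in K; that is, there is no element t ∈ K with t² = aα. -/
lemma rat_no_root (x : ℚ) (h : x ^ 3 = x ^ 2 + x + 1) : False := by
  have hi : IsIntegral ℤ x := by
    refine ⟨Polynomial.X ^ 3 - (Polynomial.X ^ 2 + Polynomial.X + 1), ?_, ?_⟩
    · apply Polynomial.monic_X_pow_sub
      compute_degree
      norm_num
    · simp [h]
  obtain ⟨n, rfl⟩ := IsIntegrallyClosed.isIntegral_iff.mp hi
  simp only [eq_intCast] at h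
  have h' : n ^ 3 = n ^ 2 + n + 1 := by exact_mod_cast h
  have h1 : n * (n ^ 2 - n - 1) = 1 := by linarith
  rcases Int.eq_one_or_neg_one_of_mul_eq_one h1 with rfl | rfl <;> norm_num at h'

lemma alpha_lin (α : ℝ) (hα : α ^ 3 = α ^ 2 + α + 1) (c d : ℚ)
    (h : (c : ℝ) + d * α = 0) : c = 0 ∧ d = 0 := by
  have hd : d = 0 := by
    by_contra hd
    have hd' : (d : ℝ) ≠ 0 := by exact_mod_cast hd
    have h1 : α = ((-c / d : ℚ) : ℝ) := by
      push_cast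
      field_simp
      linarith
    rw [h1] at hα
    exact rat_no_root (-c / d) (by exact_mod_cast hα)
  subst hd
  simp at h
  exact ⟨h, rfl⟩

lemma alpha_quad (α : ℝ) (hα : α ^ 3 = α ^ 2 + α + 1) (c d e : ℚ)
    (h : (c : ℝ) + d * α + e * α ^ 2 = 0) : c = 0 ∧ d = 0 ∧ e = 0 := by
  have he : e = 0 := by
    by_contra he
    have he' : (e : ℝ) ≠ 0 := by exact_mod_cast he
    obtain ⟨b, hb⟩ : ∃ b : ℚ, b = -d / e := ⟨_, rfl⟩
    obtain ⟨k, hk⟩ : ∃ k : ℚ, k = -c / e := ⟨_, rfl⟩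
    have h2 : α ^ 2 = b * α + k := by
      rw [hb, hk]
      push_cast
      field_simp
      linarith
    have h3 := alpha_lin α hα (b * k - k - 1) (b ^ 2 + k - b - 1) (by
      push_cast
      linear_combination hα + (-b + 1 - α) * h2)
    exact rat_no_root (1 - b) (by
      linear_combination h3.1 + (1 - b) * h3.2)
  subst he
  have := alpha_lin α hα c d (by simpa using h)
  exact ⟨this.1, this.2, rfl⟩

lemma mem_adjoin_alpha (α : ℝ) (hα : α ^ 3 = α ^ 2 + α + 1) (u : ℝ)
    (hu : u ∈ Algebra.adjoin ℚ {α}) :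
    ∃ p q r : ℚ, u = p + q * α + r * α ^ 2 := by
  induction hu using Algebra.adjoin_induction with
  | mem x hx =>
    rw [Set.mem_singleton_iff] at hx
    exact ⟨0, 1, 0, by simp [hx]⟩
  | algebraMap r => exact ⟨r, 0, 0, by simp⟩
  | add x y _ _ hx hy =>
    obtain ⟨p, q, r, rfl⟩ := hx
    obtain ⟨p', q', r', rfl⟩ := hy
    exact ⟨p + p', q + q', r + r', by push_cast; ring⟩
  | mul x y _ _ hx hy =>
    obtain ⟨p, q, r, rfl⟩ := hx
    obtain ⟨a, b, c, rfl⟩ := hy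
    refine ⟨p * a + (q * c + r * b) + r * c, p * b + q * a + (q * c + r * b) + 2 * (r * c),
      p * c + q * b + r * a + (q * c + r * b) + 2 * (r * c), ?_⟩
    push_cast
    linear_combination (q * c + r * b + r * c + r * c * α) * hα

lemma not_sq_44 (x : ℚ) (h : 44 * x ^ 2 = 1) : False := by
  have h1 : IsSquare ((11 : ℕ) : ℚ) := ⟨22 * x, by push_cast; linarith⟩
  rw [Rat.isSquare_natCast_iff] at h1
  obtain ⟨n, hn⟩ := h1
  have : n < 4 := by nlinarith
  interval_cases n <;> omega

lemma not_sq_real (α : ℝ) (hα : α ^ 3 = α ^ 2 + α + 1) (u : ℝ)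
    (hu : u ∈ Algebra.adjoin ℚ {α}) (h : u ^ 2 * (3 * α ^ 2 - 2 * α - 1) = α) : False := by
  obtain ⟨p, q, r, rfl⟩ := mem_adjoin_alpha α hα u hu
  obtain ⟨A, hA⟩ : ∃ A, A = p * p + (q * r + r * q) + r * r := ⟨_, rfl⟩
  obtain ⟨B, hB⟩ : ∃ B, B = p * q + q * p + (q * r + r * q) + 2 * (r * r) := ⟨_, rfl⟩
  obtain ⟨C, hC⟩ : ∃ C, C = p * r + q * q + r * p + (q * r + r * q) + 2 * (r * r) := ⟨_, rfl⟩
  have hs : ((p : ℝ) + q * α + r * α ^ 2) ^ 2 = A + B * α + C * α ^ 2 := by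
    rw [hA, hB, hC]
    push_cast
    linear_combination (q * r + r * q + r * r + r * r * α : ℝ) * hα
  rw [hs] at h
  obtain ⟨e1, e2, e3⟩ := alpha_quad α hα
    (-A + (3 * B - 2 * C) + 3 * C)
    (-2 * A - B + (3 * B - 2 * C) + 2 * (3 * C) - 1)
    (3 * A - 2 * B - C + (3 * B - 2 * C) + 2 * (3 * C)) (by
      push_cast
      linear_combination h - (3 * B - 2 * C + 3 * C + 3 * C * α : ℝ) * hα)
  have hC' : C = 5 / 22 := by linarith
  have hB' : B = -3 / 22 := by linarith
  have hA' : A = -4 / 22 := by linarith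
  have hN : A * ((A + C) * (A + B + 2 * C) - (B + C) * (B + 2 * C))
      - B * (C * (A + B + 2 * C) - (B + C) * (B + C))
      + C * (C * (B + 2 * C) - (A + C) * (B + C)) =
      (p * ((p + r) * (p + q + 2 * r) - (q + r) * (q + 2 * r))
      - q * (r * (p + q + 2 * r) - (q + r) * (q + r))
      + r * (r * (q + 2 * r) - (p + r) * (q + r))) ^ 2 := by
    rw [hA, hB, hC]
    ring
  refine not_sq_44 (p * ((p + r) * (p + q + 2 * r) - (q + r) * (q + 2 * r))
      - q * (r * (p + q + 2 * r) - (q + r) * (q + r))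
      + r * (r * (q + 2 * r) - (p + r) * (q + r))) ?_
  rw [← hN, hA', hB', hC']
  norm_num

lemma mem_K (α : ℝ) (hα : α ^ 3 = α ^ 2 + α + 1)
    (β : ℂ) (hβ : β ^ 3 = β ^ 2 + β + 1)
    (hq : β ^ 2 = (1 - α) * β - (α ^ 2 - α - 1)) (t : ℂ)
    (ht : t ∈ IntermediateField.adjoin ℚ {(α : ℂ), β}) :
    ∃ u ∈ Algebra.adjoin ℚ {α}, ∃ v ∈ Algebra.adjoin ℚ {α}, t = (u : ℂ) + (v : ℂ) * β := by
  have hint : ∀ x : ℂ, x ^ 3 = x ^ 2 + x + 1 → IsAlgebraic ℚ x := by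
    intro x hx
    apply IsIntegral.isAlgebraic
    refine ⟨Polynomial.X ^ 3 - (Polynomial.X ^ 2 + Polynomial.X + 1), ?_, ?_⟩
    · apply Polynomial.monic_X_pow_sub
      compute_degree
      norm_num
    · simp [hx]
  have hA : ∀ x ∈ ({(α : ℂ), β} : Set ℂ), IsAlgebraic ℚ x := by
    rintro x (rfl | rfl)
    · exact hint _ (by exact_mod_cast hα)
    · exact hint _ hβ
  rw [← IntermediateField.mem_toSubalgebra,
    IntermediateField.adjoin_toSubalgebra_of_isAlgebraic hA] at ht
  have ha : α ∈ Algebra.adjoin ℚ {α} := Algebra.subset_adjoin rfl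
  induction ht using Algebra.adjoin_induction with
  | mem x hx =>
    rcases hx with rfl | rfl
    · exact ⟨α, ha, 0, zero_mem _, by simp⟩
    · exact ⟨0, zero_mem _, 1, one_mem _, by simp⟩
  | algebraMap r => exact ⟨algebraMap ℚ ℝ r, algebraMap_mem _ _, 0, zero_mem _, by simp⟩
  | add x y _ _ hx hy =>
    obtain ⟨u, hu, v, hv, rfl⟩ := hx
    obtain ⟨u', hu', v', hv', rfl⟩ := hy
    exact ⟨u + u', add_mem hu hu', v + v', add_mem hv hv', by push_cast; ring⟩
  | mul x y _ _ hx hy =>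
    obtain ⟨u, hu, v, hv, rfl⟩ := hx
    obtain ⟨u', hu', v', hv', rfl⟩ := hy
    have h1 := one_mem (Algebra.adjoin ℚ {α})
    refine ⟨u * u' - v * v' * (α ^ 2 - α - 1), ?_, u * v' + v * u' + v * v' * (1 - α), ?_, ?_⟩
    · exact sub_mem (mul_mem hu hu') (mul_mem (mul_mem hv hv')
        (sub_mem (sub_mem (pow_mem ha 2) ha) h1))
    · exact add_mem (add_mem (mul_mem hu hv') (mul_mem hv hu'))
        (mul_mem (mul_mem hv hv') (sub_mem h1 ha))
    · push_cast
      linear_combination (v * v' : ℂ) * hq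

/-- The element `a·α`, where `a = 1/((α-β)(α-γ))`, is not a square in the splitting
field `K = ℚ(α, β)` of `x³ - x² - x - 1`. -/
theorem a_mul_alpha_not_square (α : ℝ) (hα : α ^ 3 = α ^ 2 + α + 1)
    (β γ : ℂ) (hβ : β ^ 3 = β ^ 2 + β + 1) (hβim : β.im ≠ 0)
    (hγ : γ = starRingEnd ℂ β) :
    ¬ ∃ t : IntermediateField.adjoin ℚ {(α : ℂ), β},
      (t : ℂ) ^ 2 = (1 / (((α : ℂ) - β) * ((α : ℂ) - γ))) * (α : ℂ) := by
  rintro ⟨⟨t, ht⟩, h⟩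
  simp only at h
  have hαC : (α : ℂ) ^ 3 = (α : ℂ) ^ 2 + α + 1 := by exact_mod_cast hα
  have hne : β - α ≠ 0 := by
    intro h0
    apply hβim
    have := congrArg Complex.im h0
    simpa using this
  have hq : β ^ 2 = (1 - α) * β - ((α : ℂ) ^ 2 - α - 1) := by
    apply mul_left_cancel₀ hne
    linear_combination hβ - hαC
  obtain ⟨u, hu, v, hv, rfl⟩ := mem_K α hα β hβ hq t ht
  have hpos : 0 < α := by
    by_contra hn
    nlinarith [sq_nonneg (α + 1), sq_nonneg α, mul_nonneg (sq_nonneg α) (neg_nonneg.mpr (not_lt.mp hn))]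
  have him := congrArg Complex.im hq
  have hre := congrArg Complex.re hq
  simp [pow_two] at him hre
  have hr : β.re = (1 - α) / 2 := by
    apply mul_left_cancel₀ hβim
    linarith
  have hD : ((α : ℂ) - β) * ((α : ℂ) - γ) = ((3 * α ^ 2 - 2 * α - 1 : ℝ) : ℂ) := by
    rw [hγ]
    apply Complex.ext
    · simp [pow_two]
      rw [hr] at hre ⊢
      linarith
    · simp [pow_two]
      ring
  have hDpos : 0 < 3 * α ^ 2 - 2 * α - 1 := by
    have : 3 * α ^ 2 - 2 * α - 1 = (α - β.re) ^ 2 + β.im ^ 2 := by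
      rw [hr] at hre ⊢
      linarith
    rw [this]
    positivity
  have hDC : ((3 * α ^ 2 - 2 * α - 1 : ℝ) : ℂ) ≠ 0 := by exact_mod_cast hDpos.ne'
  have h2 : ((u : ℂ) + v * β) ^ 2 = ((α / (3 * α ^ 2 - 2 * α - 1) : ℝ) : ℂ) := by
    rw [h, hD, Complex.ofReal_div]
    ring
  have hR : 0 < α / (3 * α ^ 2 - 2 * α - 1) := div_pos hpos hDpos
  have h2i := congrArg Complex.im h2
  have h2r := congrArg Complex.re h2
  rw [Complex.ofReal_im, pow_two, Complex.mul_im] at h2i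
  rw [Complex.ofReal_re, pow_two, Complex.mul_re] at h2r
  have hi : ((u : ℂ) + v * β).im = v * β.im := by simp
  rw [hi] at h2i h2r
  have hv0 : v = 0 := by
    have h3 : ((u : ℂ) + v * β).re * (v * β.im) = 0 := by linarith
    rcases mul_eq_zero.mp h3 with h4 | h4
    · rw [h4] at h2r
      nlinarith [mul_self_nonneg (v * β.im)]
    · exact (mul_eq_zero.mp h4).resolve_right hβim
  subst hv0
  simp at h2r
  apply not_sq_real α hα u hu
  rw [pow_two u, h2r]
  exact div_mul_cancel₀ _ hDpos.ne'
end

section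
/- Let u, v, w be integers with 1 ≤ u < v < w and let x, y, z be positive integers with 1 + uv = T_x, 1 + uw = T_y and 1 + vw = T_z. Then 5 ≤ x < y < z and x + y > z (hence y > z/2). -/
theorem T_step (n : ℕ) : T n ≤ T (n + 1) := by
  match n with
  | 0 => simp [T]
  | 1 => simp [T]
  | (k + 2) =>
    show T (k + 2) ≤ T (k + 3)
    rw [T]; omega

theorem T_mono : Monotone T := monotone_nat_of_le_succ T_step

theorem T_mul (x : ℕ) : ∀ y : ℕ, T x * T y ≤ T (x + y)
  | 0 => by simp [T]
  | 1 => by simp [T]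
  | 2 => by
    have h : T x ≤ T (x + 2) := T_mono (by omega)
    simpa [T] using h
  | (n + 3) => by
    have a := T_mul x n
    have b := T_mul x (n + 1)
    have c := T_mul x (n + 2)
    have e : T (x + (n + 3)) = T (x + (n + 2)) + T (x + (n + 1)) + T (x + n) := by
      show T ((x + n) + 3) = _
      rw [T]; rfl
    rw [e, T, mul_add, mul_add]
    omega

/-- For a Tribonacci Diophantine triple `1 ≤ u < v < w` with `1 + uv = T x`,
`1 + uw = T y`, `1 + vw = T z`, one has `5 ≤ x < y < z` and `x + y > z`
(hence `y > z/2`). -/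
theorem tribonacci_triple_indices (u v w : ℤ) (hu : 1 ≤ u) (huv : u < v)
    (hvw : v < w) (x y z : ℕ) (hx : 0 < x) (hy : 0 < y) (hz : 0 < z)
    (h1 : 1 + u * v = (T x : ℤ)) (h2 : 1 + u * w = (T y : ℤ))
    (h3 : 1 + v * w = (T z : ℤ)) :
    5 ≤ x ∧ x < y ∧ y < z ∧ z < x + y ∧ (z : ℚ) / 2 < (y : ℚ) := by
  have a : 5 ≤ x := by
    by_contra h
    have h4 : T x ≤ T 4 := T_mono (by omega)
    have h5 : T 4 = 2 := by simp [T]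
    have h6 : (T x : ℤ) ≤ 2 := by omega
    nlinarith
  have b : x < y := T_mono.reflect_lt (by
    have : (T x : ℤ) < T y := by rw [← h1, ← h2]; nlinarith
    exact_mod_cast this)
  have c : y < z := T_mono.reflect_lt (by
    have : (T y : ℤ) < T z := by rw [← h2, ← h3]; nlinarith
    exact_mod_cast this)
  have d : z < x + y := T_mono.reflect_lt (by
    refine lt_of_lt_of_le ?_ (T_mul x y)
    have : (T z : ℤ) < T x * T y := by
      rw [← h1, ← h2, ← h3]
      have p1 : 0 < u * v := by apply mul_pos <;> omega
      have p2 : 0 < u * w := by apply mul_pos <;> omega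
      have p3 : 0 < v * w := by apply mul_pos <;> omega
      have p4 : 1 ≤ u * u := by nlinarith
      nlinarith [mul_le_mul_of_nonneg_right p4 p3.le]
    exact_mod_cast this)
  refine ⟨a, b, c, d, ?_⟩
  have e : z < y * 2 := by omega
  have e' : (z : ℚ) < y * 2 := by exact_mod_cast e
  linarith
end

section
/- For all integers y, z with 4 ≤ y < z, the complex (in fact real) number α^{z−y}·(T_y − 1) − (T_z − 1) is nonzero; equivalently, α^{z−y} ≠ (T_z − 1)/(T_y − 1). -/
lemma T_mono_aux (n : ℕ) : 2 ≤ T (n + 4) ∧ 1 ≤ T (n + 3) := by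
  induction n with
  | zero => simp [T]
  | succ k ih =>
    refine ⟨?_, by have := ih.1; show 1 ≤ T (k + 4); omega⟩
    have h : T (k + 1 + 4) = T (k + 4) + T (k + 3) + T (k + 2) := rfl
    omega

lemma int_of_rat_integral (q : ℚ) (h : IsIntegral ℤ (q : ℝ)) : ∃ m : ℤ, (m : ℝ) = q := by
  have h1 : IsIntegral ℤ q := by
    have h2 : IsIntegral ℤ (algebraMap ℚ ℝ q) := by simpa using h
    exact (isIntegral_algebraMap_iff (algebraMap ℚ ℝ).injective).1 h2
  obtain ⟨m, hm⟩ := IsIntegrallyClosed.isIntegral_iff.1 h1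
  refine ⟨m, ?_⟩
  rw [← hm]
  simp

/-- For `4 ≤ y < z`, the real number `α^(z-y)·(T y - 1) - (T z - 1)` is nonzero,
where `α` is the unique real root of `x³ - x² - x - 1`. -/
theorem alpha_pow_mul_ne (α : ℝ) (hα : α ^ 3 = α ^ 2 + α + 1)
    (y z : ℕ) (hy : 4 ≤ y) (hyz : y < z) :
    α ^ (z - y) * ((T y : ℝ) - 1) - ((T z : ℝ) - 1) ≠ 0 := by
  intro h
  have ha : 1 < α := by
    have e : (α + 1/3)^2 * (α - 5/3) = 22/27 := by linear_combination hα
    by_contra hc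
    push Not at hc
    nlinarith [mul_nonneg (sq_nonneg (α + 1/3)) (by linarith : 0 ≤ 5/3 - α)]
  have hn : z - y ≠ 0 := by omega
  have hp : 1 < α ^ (z - y) := one_lt_pow₀ ha hn
  have hT : 2 ≤ T y := by
    obtain ⟨k, rfl⟩ := Nat.exists_eq_add_of_le' hy
    exact (T_mono_aux k).1
  have hT' : (2 : ℝ) ≤ T y := by exact_mod_cast hT
  have hi : IsIntegral ℤ α := by
    refine ⟨Polynomial.X ^ 3 - Polynomial.X ^ 2 - Polynomial.X - 1, by monicity!, ?_⟩
    simp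
    linarith
  have hmul : α * (α ^ 2 - α - 1) = 1 := by linear_combination hα
  have hi' : IsIntegral ℤ (α ^ 2 - α - 1) := ((hi.pow 2).sub hi).sub isIntegral_one
  generalize z - y = n at *
  have hpm : α ^ n * (α ^ 2 - α - 1) ^ n = 1 := by rw [← mul_pow, hmul, one_pow]
  have hq : α ^ n = ((((T z : ℚ) - 1) / ((T y : ℚ) - 1) : ℚ) : ℝ) := by
    push_cast
    rw [eq_div_iff (by linarith)]
    linarith
  have hI := hi.pow n
  have hI' := hi'.pow n
  have hq' : (α ^ 2 - α - 1) ^ n = (((((T z : ℚ) - 1) / ((T y : ℚ) - 1))⁻¹ : ℚ) : ℝ) := by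
    rw [Rat.cast_inv, ← hq]
    exact eq_inv_of_mul_eq_one_right hpm
  rw [hq] at hI
  rw [hq'] at hI'
  obtain ⟨m, hm⟩ := int_of_rat_integral _ hI
  obtain ⟨k, hk⟩ := int_of_rat_integral _ hI'
  rw [← hq] at hm
  rw [← hq'] at hk
  rw [← hm, ← hk] at hpm
  rw [← hm] at hp
  have h1 : m * k = 1 := by exact_mod_cast hpm
  have h2 : 1 < m := by exact_mod_cast hp
  rcases Int.eq_one_or_neg_one_of_mul_eq_one h1 with h3 | h3 <;> omega
end

section
/- For every positive integer λ, the real number α^λ is irrational. -/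
/-- For every positive integer `λ`, the real number `α^λ` is irrational, where `α`
is the unique real root of `x³ - x² - x - 1`. -/
theorem alpha_pow_irrational (α : ℝ) (hα : α ^ 3 = α ^ 2 + α + 1)
    (l : ℕ) (hl : 0 < l) :
    Irrational (α ^ l) := by
  have h1 : 1 < α := by
    by_contra h
    push Not at h
    have e : (1 - α) ^ 2 * (1 + α) = 2 := by linear_combination hα
    have hp : 0 < 1 + α := by
      by_contra h'
      push Not at h'
      nlinarith [mul_nonneg (sq_nonneg (1 - α)) (neg_nonneg.2 h')]
    nlinarith [mul_nonneg (sq_nonneg (3 * α + 1)) (show 0 ≤ 5 / 3 - α by linarith)]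
  have hi : IsIntegral ℤ α := by
    refine ⟨Polynomial.X ^ 3 - (Polynomial.X ^ 2 + Polynomial.X + 1), ?_, ?_⟩
    · monicity!
    · simp [Polynomial.eval₂_add, Polynomial.eval₂_sub, hα]
  have hab : α * (α ^ 2 - α - 1) = 1 := by linear_combination hα
  obtain ⟨b, hb⟩ : ∃ b, b = α ^ 2 - α - 1 := ⟨_, rfl⟩
  rw [← hb] at hab
  have hbi : IsIntegral ℤ (b ^ l) := by
    rw [hb]
    exact (((hi.pow 2).sub hi).sub isIntegral_one).pow l
  have hb0 : 0 < b := by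
    by_contra h
    push Not at h
    nlinarith
  have hb1 : b < 1 := by nlinarith
  rintro ⟨q, hq⟩
  have hbq : b ^ l = ((q⁻¹ : ℚ) : ℝ) := by
    push_cast
    rw [hq]
    refine eq_inv_of_mul_eq_one_right ?_
    rw [← mul_pow, hab, one_pow]
  have hqi : IsIntegral ℤ (q⁻¹ : ℚ) := by
    rw [hbq] at hbi
    exact (isIntegral_algebraMap_iff (algebraMap ℚ ℝ).injective).1 hbi
  obtain ⟨n, hn⟩ := IsIntegrallyClosed.isIntegral_iff.1 hqi
  have hn' : (n : ℝ) = b ^ l := by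
    rw [hbq, ← hn]; simp
  have h2 : 0 < b ^ l := pow_pos hb0 l
  have h3 : b ^ l < 1 := pow_lt_one₀ hb0.le hb1 hl.ne'
  rw [← hn'] at h2 h3
  have h4 : 0 < n := by exact_mod_cast h2
  have h5 : n < 1 := by exact_mod_cast h3
  omega
end

section
/- There are no integers n ≠ 0, m_α < 0, m_β > 0, m_γ > 0 such that (α^{m_α} · β^{m_β} · γ^{m_γ})^n = 1 in ℂ; in other words, for such exponents the complex number α^{m_α} · β^{m_β} · γ^{m_γ} is never a root of unity. -/
/-- There are no integers `n ≠ 0`, `mα < 0`, `mβ > 0`, `mγ > 0` with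
`(α^mα · β^mβ · γ^mγ)^n = 1`, where `α` is the real root and `β, γ = conj β` the
non-real roots of `x³ - x² - x - 1`; i.e. `α^mα · β^mβ · γ^mγ` is never a root of
unity for such exponents. -/
theorem no_root_of_unity (α : ℝ) (hα : α ^ 3 = α ^ 2 + α + 1)
    (β γ : ℂ) (hβ : β ^ 3 = β ^ 2 + β + 1) (hβim : β.im ≠ 0)
    (hγ : γ = starRingEnd ℂ β) :
    ¬ ∃ (n mα mβ mγ : ℤ), n ≠ 0 ∧ mα < 0 ∧ 0 < mβ ∧ 0 < mγ ∧
      ((α : ℂ) ^ mα * β ^ mβ * γ ^ mγ) ^ n = 1 := by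
  rintro ⟨n, a, b, c, hn, ha, hb, hc, h⟩
  have hα1 : 1 < α := by
    by_contra hle
    push Not at hle
    nlinarith [mul_nonneg (sub_nonneg.2 hle) (sq_nonneg (3 * α + 1)), sq_nonneg (3 * α + 1)]
  have hns : Complex.normSq β < 1 := by
    obtain ⟨x, y⟩ := β
    have hre := congrArg Complex.re hβ
    have him := congrArg Complex.im hβ
    simp [pow_succ] at hre him
    simp at hβim
    have h1 : y ^ 2 = 3 * x ^ 2 - 2 * x - 1 := by
      apply mul_left_cancel₀ hβim
      linarith
    have hy : 0 < y ^ 2 := by positivity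
    have h2 : 4 * x ^ 3 - 4 * x ^ 2 + 1 = 0 := by
      have e : x ^ 3 - 3 * x * y ^ 2 = x ^ 2 - y ^ 2 + x + 1 := by linarith
      rw [h1] at e
      linarith
    have hx1 : x < 1 := by
      by_contra hx
      push Not at hx
      nlinarith [mul_nonneg (sq_nonneg x) (sub_nonneg.2 hx)]
    have hx2 : -1 / 2 < x := by
      by_contra hx
      push Not at hx
      nlinarith [mul_nonneg (sq_nonneg x) (sub_nonneg.2 hx)]
    rw [Complex.normSq_mk]
    nlinarith [mul_pos (sub_pos.2 hx1) (sub_pos.2 hx2)]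
  have hb1 : ‖β‖ < 1 := by
    rw [Complex.normSq_eq_norm_sq] at hns
    nlinarith [norm_nonneg β]
  have hb0 : 0 < ‖β‖ := by
    rw [norm_pos_iff]
    rintro rfl
    simp at hβim
  have hN := congrArg norm h
  rw [norm_zpow, norm_mul, norm_mul, norm_zpow, norm_zpow, norm_zpow, hγ, RCLike.norm_conj,
    Complex.norm_real, Real.norm_of_nonneg (by linarith), norm_one] at hN
  have hα0 : 0 < α := by linarith
  have e1 : α ^ a < 1 := zpow_lt_one_of_neg₀ hα1 ha
  have e2 : ‖β‖ ^ b < 1 := zpow_lt_one₀ hb0 hb1 hb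
  have e3 : ‖β‖ ^ c < 1 := zpow_lt_one₀ hb0 hb1 hc
  have p1 : 0 < α ^ a := zpow_pos hα0 _
  have p2 : 0 < ‖β‖ ^ b := zpow_pos hb0 _
  have p3 : 0 < ‖β‖ ^ c := zpow_pos hb0 _
  have q : α ^ a * ‖β‖ ^ b * ‖β‖ ^ c < 1 :=
    mul_lt_one_of_nonneg_of_lt_one_left (by positivity)
      (mul_lt_one_of_nonneg_of_lt_one_left p1.le e1 e2.le) e3.le
  exact absurd ((zpow_eq_one_iff_right₀ (by positivity) q.ne).1 hN) hn
end

section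
/- α and β are multiplicatively independent: if k and l are integers with α^k · β^l = 1 in ℂ, then k = 0 and l = 0. -/
lemma trib_pow (n : ℕ) : ∃ a b c : ℤ, ∀ x : ℂ, x ^ 3 = x ^ 2 + x + 1 →
    x ^ n = a + b * x + c * x ^ 2 := by
  induction n with
  | zero => exact ⟨1, 0, 0, fun x _ => by simp⟩
  | succ n ih =>
    obtain ⟨a, b, c, h⟩ := ih
    refine ⟨c, a + c, b + c, fun x hx => ?_⟩
    rw [pow_succ, h x hx]
    push_cast
    linear_combination (c : ℂ) * hx

lemma trib_irr (r : ℚ) (h : r ^ 3 = r ^ 2 + r + 1) : False := by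
  have hi : IsIntegral ℤ r := by
    refine ⟨Polynomial.X ^ 3 - Polynomial.X ^ 2 - Polynomial.X - 1, ?_, ?_⟩
    · monicity!
    · simp [h]
      ring
  obtain ⟨m, hm⟩ := IsIntegrallyClosed.isIntegral_iff.1 hi
  simp only [eq_intCast] at hm
  subst hm
  have h2 : m ^ 3 = m ^ 2 + m + 1 := by exact_mod_cast h
  have h3 : m * (m ^ 2 - m - 1) = 1 := by linarith
  rcases Int.eq_one_or_neg_one_of_mul_eq_one h3 with rfl | rfl <;> norm_num at h2

/-- `α` and `β` are multiplicatively independent, where `α` is the real root and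
`β` a non-real root of `x³ - x² - x - 1`: if `α^k · β^l = 1` with `k, l ∈ ℤ`, then
`k = 0` and `l = 0`. -/
theorem alpha_beta_mult_indep (α : ℝ) (hα : α ^ 3 = α ^ 2 + α + 1)
    (β : ℂ) (hβ : β ^ 3 = β ^ 2 + β + 1) (hβim : β.im ≠ 0)
    (k l : ℤ) (h : (α : ℂ) ^ k * β ^ l = 1) :
    k = 0 ∧ l = 0 := by
  have hα1 : 5 / 3 < α := by
    by_contra hc
    push Not at hc
    nlinarith [mul_nonneg (sub_nonneg.2 hc) (sq_nonneg (α + 1 / 3)), sq_nonneg (α + 1/3)]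
  have him := congrArg Complex.im hβ
  have hre := congrArg Complex.re hβ
  simp only [pow_succ, pow_zero, one_mul, Complex.mul_re, Complex.mul_im, Complex.add_re,
    Complex.add_im, Complex.one_re, Complex.one_im] at him hre
  have e1 : 3 * β.re ^ 2 - β.im ^ 2 = 2 * β.re + 1 := by
    apply mul_right_cancel₀ hβim
    linear_combination him
  have e2 : -8 * β.re ^ 3 + 8 * β.re ^ 2 - 2 = 0 := by
    linear_combination hre + (-3 * β.re + 1) * e1
  have hs : α = 1 - 2 * β.re := by
    have hp : (α - (1 - 2 * β.re)) * ((1 - 2 * β.re) ^ 2 + (1 - 2 * β.re) * α + α ^ 2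
        - (1 - 2 * β.re) - α - 1) = 0 := by
      linear_combination hα - e2
    rcases mul_eq_zero.1 hp with h0 | h0
    · linarith
    · exfalso
      nlinarith [sq_nonneg (2 * (1 - 2 * β.re) + α - 1), mul_pos (sub_pos.2 hα1) (sub_pos.2 hα1)]
  have hn : α * Complex.normSq β = 1 := by
    rw [Complex.normSq_apply, hs]
    linear_combination e2 - (1 - 2 * β.re) * e1
  have hα0 : 0 < α := by linarith
  have hnα : Complex.normSq β = α⁻¹ := eq_inv_of_mul_eq_one_right hn
  have hβ0 : β ≠ 0 := fun h0 => hβim (by simp [h0])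
  have hnorm := congrArg Complex.normSq h
  simp only [map_mul, map_zpow₀, Complex.normSq_ofReal, map_one, hnα] at hnorm
  have hl : l = 2 * k := by
    have : α ^ (2 * k - l) = α ^ (0 : ℤ) := by
      rw [zpow_zero, ← hnorm, mul_zpow, inv_zpow', ← zpow_add₀ hα0.ne', ← zpow_add₀ hα0.ne']
      congr 1; ring
    have := zpow_right_injective₀ hα0 (by linarith) this
    omega
  have hn' : (α : ℂ) * (β * (starRingEnd ℂ) β) = 1 := by
    rw [Complex.mul_conj]; exact_mod_cast hn
  have hcz : β ^ k = ((starRingEnd ℂ) β) ^ k := by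
    have hαc : (α : ℂ) ≠ 0 := by exact_mod_cast hα0.ne'
    have h1 : ((α : ℂ) * (β * (starRingEnd ℂ) β)) ^ k = 1 := by rw [hn', one_zpow]
    rw [mul_zpow, mul_zpow] at h1
    rw [hl, two_mul, zpow_add₀ hβ0] at h
    have hne : (α : ℂ) ^ k * β ^ k ≠ 0 := mul_ne_zero (zpow_ne_zero _ hαc) (zpow_ne_zero _ hβ0)
    apply mul_left_cancel₀ hne
    linear_combination h - h1
  have hcn : β ^ k.natAbs = ((starRingEnd ℂ) β) ^ k.natAbs := by
    rcases Int.natAbs_eq k with hk | hk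
    · rw [hk, zpow_natCast, zpow_natCast] at hcz; exact hcz
    · rw [hk, zpow_neg, zpow_neg, zpow_natCast, zpow_natCast] at hcz; exact inv_injective hcz
  obtain ⟨a, b, c, H⟩ := trib_pow k.natAbs
  have hβc : ((starRingEnd ℂ) β) ^ 3 = ((starRingEnd ℂ) β) ^ 2 + (starRingEnd ℂ) β + 1 := by
    simpa using congrArg (starRingEnd ℂ) hβ
  have hαc3 : (α : ℂ) ^ 3 = (α : ℂ) ^ 2 + α + 1 := by exact_mod_cast hα
  have hI := hcn
  rw [H β hβ, H _ hβc] at hI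
  have hI2 := congrArg Complex.im hI
  simp [pow_two] at hI2
  have hbc : (b : ℝ) + c * (1 - α) = 0 := by
    apply mul_right_cancel₀ hβim
    rw [hs]
    linarith
  have hc : c = 0 := by
    by_contra hc
    have hc' : (c : ℝ) ≠ 0 := by exact_mod_cast hc
    have hr : α = (((b + c : ℤ) / c : ℚ) : ℝ) := by
      push_cast
      field_simp
      linarith
    rw [hr] at hα
    exact trib_irr _ (by exact_mod_cast hα)
  have hb : b = 0 := by
    rw [hc] at hbc; simpa using hbc
  have hEq : (α : ℂ) ^ k.natAbs = β ^ k.natAbs := by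
    rw [H _ hαc3, H _ hβ, hb, hc]; simp
  have hN := congrArg Complex.normSq hEq
  simp only [map_pow, Complex.normSq_ofReal, hnα] at hN
  have hk : k.natAbs = 0 := by
    by_contra hk
    have h1 : 1 < (α * α) ^ k.natAbs := one_lt_pow₀ (by nlinarith) hk
    have h2 : (α⁻¹) ^ k.natAbs < 1 :=
      pow_lt_one₀ (by positivity) (inv_lt_one_of_one_lt₀ (by linarith)) hk
    linarith
  omega
end

section
/- Let ε = (α + √(α² − 4))/2 ∈ ℂ, where √(α² − 4) denotes a complex square root of the negative real number α² − 4 (so ε satisfies ε + 1/ε = α). Then ε is a root of the polynomial p(x) = x⁶ − x⁵ + 2x⁴ − 3x³ + 2x² − x + 1, and moreover α = −ε⁵ + ε⁴ − 2ε³ + 3ε² − ε + 1. -/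
/-- Let `ε = (α + √(α² - 4))/2 ∈ ℂ`, where `√(α² - 4)` is a complex square root of
the negative real number `α² - 4` and `α` is the real root of `x³ - x² - x - 1`.
Then `ε` is a root of `p(x) = x⁶ - x⁵ + 2x⁴ - 3x³ + 2x² - x + 1` and
`α = -ε⁵ + ε⁴ - 2ε³ + 3ε² - ε + 1`. -/
theorem epsilon_root_and_alpha_repr (α : ℝ) (hα : α ^ 3 = α ^ 2 + α + 1)
    (s : ℂ) (hs : s ^ 2 = (α : ℂ) ^ 2 - 4) (ε : ℂ) (hε : ε = ((α : ℂ) + s) / 2) :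
    ε ^ 6 - ε ^ 5 + 2 * ε ^ 4 - 3 * ε ^ 3 + 2 * ε ^ 2 - ε + 1 = 0 ∧
    (α : ℂ) = -ε ^ 5 + ε ^ 4 - 2 * ε ^ 3 + 3 * ε ^ 2 - ε + 1 := by
  have h : (α : ℂ) * ε = ε ^ 2 + 1 := by
    rw [hε]
    linear_combination (-1 / 4 : ℂ) * hs
  have hc : (α : ℂ) ^ 3 = (α : ℂ) ^ 2 + α + 1 := by exact_mod_cast hα
  have hp : ε ^ 6 - ε ^ 5 + 2 * ε ^ 4 - 3 * ε ^ 3 + 2 * ε ^ 2 - ε + 1 = 0 := by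
    have e : ε ^ 6 - ε ^ 5 + 2 * ε ^ 4 - 3 * ε ^ 3 + 2 * ε ^ 2 - ε + 1
        = (ε ^ 2 + 1) ^ 3 - ε * (ε ^ 2 + 1) ^ 2 - ε ^ 2 * (ε ^ 2 + 1) - ε ^ 3 := by ring
    rw [e, ← h]
    linear_combination ε ^ 3 * hc
  have h0 : ε ≠ 0 := by
    rintro h0
    rw [h0] at hp
    norm_num at hp
  refine ⟨hp, mul_left_cancel₀ h0 ?_⟩
  linear_combination h + hp
end
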